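/- arXiv:1810.06182 — 7 statements merged into one kernel-verified Lean document; each statement's English description precedes it below -/
import Mathlib

section
/- Let T be an unweighted tree with vertex set {1,...,n} having no vertex of degree 2, and let Δ be its squared distance matrix, with (i,j)-entry d(i,j)² where d(i,j) is the number of edges on the ij-path. Then det Δ = (-1)^n 4^{n-2} (2n - 1 - 2 Σ_{i=1}^n 1/τ_i) ∏_{i=1}^n τ_i, where τ_i = 2 - δ_i and δ_i is the degree of vertex i. -/
open Finset Matrix

noncomputable section

/-- The degree of vertex `v` in the graph `T`. -/
def degr {n : ℕ} (T : SimpleGraph (Fin n)) (v : Fin n) : ℕ := (T.neighborSet v).ncard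

/-- The weighted distance between `u` and `v`: the sum of the weights of the edges on
the unique `uv`-path in the tree `T` (edge `e i` goes from `(E i).1` to `(E i).2` and
has weight `w i`). -/
def wdist {n : ℕ} (T : SimpleGraph (Fin n)) (hc : T.Connected)
    (E : Fin (n-1) → Fin n × Fin n) (w : Fin (n-1) → ℝ) (u v : Fin n) : ℝ :=
  (((Nonempty.some (hc.preconnected u v)).toPath : T.Walk u v).edges.map
    (fun s => ∑ i : Fin (n-1), if s = s((E i).1, (E i).2) then w i else 0)).sum

/-- The weighted distance matrix. -/
def distMat {n : ℕ} (T : SimpleGraph (Fin n)) (hc : T.Connected)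
    (E : Fin (n-1) → Fin n × Fin n) (w : Fin (n-1) → ℝ) : Matrix (Fin n) (Fin n) ℝ :=
  Matrix.of fun u v => wdist T hc E w u v

/-- The squared distance matrix. -/
def sqDistMat {n : ℕ} (T : SimpleGraph (Fin n)) (hc : T.Connected)
    (E : Fin (n-1) → Fin n × Fin n) (w : Fin (n-1) → ℝ) : Matrix (Fin n) (Fin n) ℝ :=
  Matrix.of fun u v => (wdist T hc E w u v) ^ 2

/-- The weighted degree of vertex `v`: the sum of the weights of the edges incident to `v`. -/
def wdeg {n : ℕ} (E : Fin (n-1) → Fin n × Fin n) (w : Fin (n-1) → ℝ) (v : Fin n) : ℝ :=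
  ∑ k ∈ univ.filter (fun k => (E k).1 = v ∨ (E k).2 = v), w k

/-- The weighted Laplacian matrix: for `i ≠ j` the `(i,j)`-entry is `-1/w k` if `i` and `j`
are joined by the edge `e k` and `0` otherwise; diagonal entries make all row sums zero. -/
def lap {n : ℕ} (E : Fin (n-1) → Fin n × Fin n) (w : Fin (n-1) → ℝ) :
    Matrix (Fin n) (Fin n) ℝ :=
  Matrix.of fun i j =>
    if i = j then ∑ k ∈ univ.filter (fun k => (E k).1 = i ∨ (E k).2 = i), (w k)⁻¹
    else -∑ k ∈ univ.filter (fun k => E k = (i, j) ∨ E k = (j, i)), (w k)⁻¹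

/-- The oriented vertex-edge incidence matrix. -/
def incMat {n : ℕ} (E : Fin (n-1) → Fin n × Fin n) : Matrix (Fin n) (Fin (n-1)) ℝ :=
  Matrix.of fun v e => if (E e).1 = v then 1 else if (E e).2 = v then -1 else 0

/-- The edge orientation matrix: entry `(i,j)` is `1` if `e i` and `e j` are similarly
oriented (`d((E i).1, (E j).1) = d((E i).2, (E j).2)` for the unweighted distance) and
`-1` otherwise. -/
def orientMat {n : ℕ} (T : SimpleGraph (Fin n)) (E : Fin (n-1) → Fin n × Fin n) :
    Matrix (Fin (n-1)) (Fin (n-1)) ℝ :=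
  Matrix.of fun i j => if T.dist (E i).1 (E j).1 = T.dist (E i).2 (E j).2 then 1 else -1

section treeHelpers

variable {V : Type*} [Fintype V] [DecidableEq V]

/-- Parent function of a tree rooted at `r`. -/
lemma tree_parent (T : SimpleGraph V) (hT : T.IsTree) (r : V) :
    ∃ p : V → V, (∀ j, j ≠ r → T.Adj j (p j) ∧ T.dist r j = T.dist r (p j) + 1) ∧
      (∀ j k, T.Adj j k → T.dist r j = T.dist r k + 1 → k = p j) := by
  classical
  have h : ∀ j, ∃ q, (j ≠ r → T.Adj j q ∧ T.dist r j = T.dist r q + 1) ∧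
      (∀ k, T.Adj j k → T.dist r j = T.dist r k + 1 → k = q) := by
    intro j
    obtain ⟨w, hw, hl⟩ := hT.connected.exists_path_of_dist r j
    have uniq : ∀ k, T.Adj j k → T.dist r j = T.dist r k + 1 → k = w.penultimate := by
      intro k hk hd
      obtain ⟨w', hw', hl'⟩ := hT.connected.exists_path_of_dist r k
      have hp : (w'.concat hk.symm).IsPath := by
        apply SimpleGraph.Walk.isPath_of_length_eq_dist
        simp [hl', hd]
      have := hT.isAcyclic.path_unique ⟨w, hw⟩ ⟨_, hp⟩
      have h2 : w = w'.concat hk.symm := congrArg Subtype.val this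
      rw [h2]
      simp
    refine ⟨w.penultimate, ?_, uniq⟩
    intro hj
    have hnil : ¬ w.Nil := SimpleGraph.Walk.not_nil_of_ne (Ne.symm hj)
    have hadj := (w.adj_penultimate hnil).symm
    refine ⟨hadj, ?_⟩
    rcases hT.dist_eq_dist_add_one_of_adj r hadj with h | h
    · exact h
    · exfalso
      have h1 : T.dist r w.penultimate ≤ w.dropLast.length := SimpleGraph.dist_le _
      have h2 : w.dropLast.length ≤ w.length := by simp
      omega
  choose p hp1 hp2 using h
  exact ⟨p, hp1, hp2⟩

open Classical in
/-- Real adjacency indicator. -/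
def adjR (T : SimpleGraph V) (j k : V) : ℝ := if T.Adj j k then 1 else 0

/-- Real degree. -/
def degR (T : SimpleGraph V) (j : V) : ℝ := ∑ k, adjR T j k

lemma adjR_symm (T : SimpleGraph V) (j k : V) : adjR T j k = adjR T k j := by
  unfold adjR
  by_cases h : T.Adj j k
  · rw [if_pos h, if_pos h.symm]
  · rw [if_neg h, if_neg fun h' => h h'.symm]

lemma adjR_eq (T : SimpleGraph V) (hT : T.IsTree) (r : V) (p : V → V)
    (h1 : ∀ j, j ≠ r → T.Adj j (p j) ∧ T.dist r j = T.dist r (p j) + 1)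
    (h2 : ∀ j k, T.Adj j k → T.dist r j = T.dist r k + 1 → k = p j) (j k : V) :
    adjR T j k = (if j ≠ r ∧ k = p j then 1 else 0) + (if k ≠ r ∧ j = p k then 1 else 0) := by
  unfold adjR
  by_cases hjk : T.Adj j k
  · rw [if_pos hjk]
    rcases hT.dist_eq_dist_add_one_of_adj r hjk with h | h
    · have hk := h2 j k hjk h
      have hj : j ≠ r := by
        rintro rfl
        simp at h
      rw [if_pos ⟨hj, hk⟩, if_neg]
      · simp
      · rintro ⟨a, b⟩
        have := (h1 k a).2
        rw [← b] at this
        omega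
    · have hk := h2 k j hjk.symm h
      have hj : k ≠ r := by
        rintro rfl
        simp at h
      rw [if_neg, if_pos ⟨hj, hk⟩]
      · simp
      · rintro ⟨a, b⟩
        have := (h1 j a).2
        rw [← b] at this
        omega
  · rw [if_neg hjk, if_neg, if_neg]
    · simp
    · rintro ⟨a, b⟩
      exact hjk (b ▸ (h1 k a).1.symm)
    · rintro ⟨a, b⟩
      exact hjk (b ▸ (h1 j a).1)

lemma row_sum (T : SimpleGraph V) (hT : T.IsTree) (r j : V) (f : ℝ → ℝ) :
    ∑ k, adjR T j k * f (T.dist r k) = degR T j * f (T.dist r j + 1) +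
      (if j = r then 0 else f (T.dist r j - 1) - f (T.dist r j + 1)) := by
  obtain ⟨p, h1, h2⟩ := tree_parent T hT r
  have key : ∀ k, adjR T j k * f (T.dist r k) = adjR T j k * f (T.dist r j + 1) +
      (if k = p j then (if j = r then 0 else f (T.dist r j - 1) - f (T.dist r j + 1)) else 0) := by
    intro k
    rw [adjR_eq T hT r p h1 h2]
    by_cases hj : j ≠ r ∧ k = p j
    · have hd := (h1 j hj.1).2
      have hk : ¬ (k ≠ r ∧ j = p k) := by
        rintro ⟨a, b⟩
        have := (h1 k a).2
        rw [← b] at this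
        rw [← hj.2] at hd
        omega
      rw [if_pos hj, if_neg hk, if_pos hj.2, if_neg hj.1, hd, hj.2]
      push_cast
      ring_nf
    · rw [if_neg hj]
      by_cases hk : k ≠ r ∧ j = p k
      · have hd := (h1 k hk.1).2
        rw [← hk.2] at hd
        rw [if_pos hk, hd]
        push_cast
        have : (if k = p j then (if j = r then (0:ℝ) else
          f (T.dist r j - 1) - f (T.dist r j + 1)) else 0) = 0 := by
          by_cases h : j = r
          · simp [h]
          · rw [if_neg]
            exact fun h' => hj ⟨h, h'⟩
        rw [this]
        ring
      · rw [if_neg hk]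
        have : (if k = p j then (if j = r then (0:ℝ) else
          f (T.dist r j - 1) - f (T.dist r j + 1)) else 0) = 0 := by
          by_cases h : j = r
          · simp [h]
          · rw [if_neg]
            exact fun h' => hj ⟨h, h'⟩
        rw [this]
        ring
  rw [Finset.sum_congr rfl (fun k _ => key k), Finset.sum_add_distrib, ← Finset.sum_mul]
  simp [degR]

lemma handshake (T : SimpleGraph V) (hT : T.IsTree) (r : V) (f : ℝ → ℝ) :
    ∑ j, degR T j * f (T.dist r j) =
      ∑ j, if j = r then 0 else f (T.dist r j) + f (T.dist r j - 1) := by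
  obtain ⟨p, h1, h2⟩ := tree_parent T hT r
  have e : ∀ j, degR T j * f (T.dist r j) =
      (if j = r then 0 else f (T.dist r j)) + ∑ k, if k ≠ r ∧ j = p k then f (T.dist r j) else 0 := by
    intro j
    unfold degR
    simp_rw [adjR_eq T hT r p h1 h2 j]
    rw [Finset.sum_add_distrib, add_mul, Finset.sum_mul, Finset.sum_mul]
    congr 1
    · by_cases hj : j = r <;> simp [hj]
    · simp
  rw [Finset.sum_congr rfl (fun j _ => e j), Finset.sum_add_distrib, Finset.sum_comm,
    ← Finset.sum_add_distrib]
  apply Finset.sum_congr rfl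
  intro j _
  by_cases hj : j = r
  · simp [hj]
  · have hd := (h1 j hj).2
    simp [hj, hd]

/-- Laplacian. -/
def lapR (T : SimpleGraph V) : Matrix V V ℝ :=
  Matrix.of fun i j => (if i = j then degR T j else 0) - adjR T i j

/-- The vector `τ`. -/
def tauR (T : SimpleGraph V) (j : V) : ℝ := 2 - degR T j

/-- Distance matrix. -/
def dMat (T : SimpleGraph V) : Matrix V V ℝ := Matrix.of fun i j => (T.dist i j : ℝ)

/-- Squared distance matrix. -/
def sMat (T : SimpleGraph V) : Matrix V V ℝ := Matrix.of fun i j => (T.dist i j : ℝ) ^ 2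

lemma gen_mul_lap (T : SimpleGraph V) (f : ℝ → ℝ) (i j : V) (hT : T.IsTree) :
    ((Matrix.of fun i j => f (T.dist i j)) * lapR T) i j =
      degR T j * (f (T.dist i j) - f (T.dist i j + 1)) -
      (if j = i then 0 else f (T.dist i j - 1) - f (T.dist i j + 1)) := by
  have := row_sum T hT i j f
  simp only [Matrix.mul_apply, lapR, Matrix.of_apply, mul_sub, Finset.sum_sub_distrib]
  have e : ∑ x, f (T.dist i x) * adjR T x j = ∑ x, adjR T j x * f (T.dist i x) := by
    apply Finset.sum_congr rfl
    intro x _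
    rw [adjR_symm]; ring
  rw [e, this]
  simp
  ring

lemma dMat_lap (T : SimpleGraph V) (hT : T.IsTree) (i j : V) :
    (dMat T * lapR T) i j = tauR T j - (if i = j then 2 else 0) := by
  have := gen_mul_lap T (fun x => x) i j hT
  rw [show dMat T = Matrix.of fun i j => (fun x : ℝ => x) (T.dist i j : ℝ) from rfl, this]
  by_cases h : i = j
  · simp [h, tauR]
  · simp [h, Ne.symm h, tauR]; ring

lemma sMat_lap (T : SimpleGraph V) (hT : T.IsTree) (i j : V) :
    (sMat T * lapR T) i j = 2 * T.dist i j * tauR T j - degR T j := by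
  have := gen_mul_lap T (fun x => x ^ 2) i j hT
  rw [show sMat T = Matrix.of fun i j => (fun x : ℝ => x ^ 2) (T.dist i j : ℝ) from rfl, this]
  by_cases h : i = j
  · simp [h]
  · simp [Ne.symm h, tauR]; ring

lemma sum_not_root (r : V) (g : V → ℝ) :
    (∑ j, if j = r then 0 else g j) = (∑ j, g j) - g r := by
  rw [← Finset.sum_erase_eq_sub (Finset.mem_univ r), Finset.sum_ite]
  simp [Finset.filter_ne']

lemma sum_tau (T : SimpleGraph V) (hT : T.IsTree) : ∑ j, tauR T j = 2 := by
  obtain ⟨r⟩ := hT.connected.nonempty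
  have := handshake T hT r (fun _ => 1)
  rw [sum_not_root r (fun _ => (1 : ℝ) + 1)] at this
  simp [tauR] at *
  rw [this]; ring

lemma dist_tau (T : SimpleGraph V) (hT : T.IsTree) (r : V) :
    ∑ j, (T.dist r j : ℝ) * tauR T j = Fintype.card V - 1 := by
  have := handshake T hT r (fun x => x)
  rw [sum_not_root r (fun j => (T.dist r j : ℝ) + (T.dist r j - 1))] at this
  simp only [tauR, mul_sub, Finset.sum_sub_distrib, Finset.sum_add_distrib, ← Finset.sum_mul] at *
  simp only [mul_comm (T.dist r _ : ℝ)]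
  rw [this]
  simp
  ring

lemma sq_tau (T : SimpleGraph V) (hT : T.IsTree) (r : V) :
    ∑ j, (T.dist r j : ℝ) ^ 2 * tauR T j
      = 2 * (∑ j, (T.dist r j : ℝ)) - (Fintype.card V - 1) := by
  have := handshake T hT r (fun x => x ^ 2)
  rw [sum_not_root r (fun j => (T.dist r j : ℝ) ^ 2 + (T.dist r j - 1) ^ 2)] at this
  have e : ∀ x : ℝ, x ^ 2 + (x - 1) ^ 2 = x ^ 2 * 2 - 2 * x + 1 := fun x => by ring
  simp only [e] at this
  simp only [tauR, mul_sub, Finset.sum_sub_distrib, Finset.sum_add_distrib, ← Finset.sum_mul,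
    ← Finset.mul_sum] at *
  simp only [mul_comm ((T.dist r _ : ℝ) ^ 2)]
  rw [this]
  simp
  ring

lemma tau_sq_tau (T : SimpleGraph V) (hT : T.IsTree) :
    ∑ i, tauR T i * ∑ j, (T.dist i j : ℝ) ^ 2 * tauR T j = 2 * (Fintype.card V - 1 : ℝ) ^ 2 := by
  simp_rw [sq_tau T hT, mul_sub, Finset.sum_sub_distrib, ← Finset.sum_mul, sum_tau T hT]
  have : ∑ i, tauR T i * (2 * ∑ j, (T.dist i j : ℝ))
      = 2 * ∑ j, ∑ i, (T.dist j i : ℝ) * tauR T i := by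
    rw [Finset.sum_comm, Finset.mul_sum]
    apply Finset.sum_congr rfl
    intro i _
    rw [Finset.mul_sum, Finset.mul_sum, Finset.mul_sum]
    apply Finset.sum_congr rfl
    intro j _
    rw [SimpleGraph.dist_comm]
    ring
  rw [this]
  simp_rw [dist_tau T hT]
  simp
  ring

lemma lap_symm (T : SimpleGraph V) (i j : V) : lapR T i j = lapR T j i := by
  simp only [lapR, Matrix.of_apply, adjR_symm T i j]
  by_cases h : i = j
  · simp [h]
  · simp [h, Ne.symm h]

lemma lap_row (T : SimpleGraph V) (i : V) : ∑ j, lapR T i j = 0 := by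
  simp [lapR, Finset.sum_sub_distrib, degR]

lemma det_K (T : SimpleGraph V) (hT : T.IsTree) (r : V) :
    (lapR T + Matrix.of fun i j => if i = r ∧ j = r then (1 : ℝ) else 0).det = 1 := by
  obtain ⟨p, h1, h2⟩ := tree_parent T hT r
  set N : Matrix V V ℝ := Matrix.of fun i j =>
    (if i = j then 1 else 0) - (if i ≠ r ∧ j = p i then 1 else 0) with hN
  have hdet : N.det = 1 := by
    have hb : N.BlockTriangular (fun i => OrderDual.toDual (T.dist r i)) := by
      intro i j hij
      have hij' : T.dist r i < T.dist r j := hij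
      have a : i ≠ j := by rintro rfl; omega
      have b : ¬ (i ≠ r ∧ j = p i) := by
        rintro ⟨x, y⟩
        have := (h1 i x).2
        rw [← y] at this
        omega
      simp only [hN, Matrix.of_apply, if_neg a, if_neg b, sub_zero]
    rw [hb.det]
    apply Finset.prod_eq_one
    intro a _
    convert Matrix.det_one (R := ℝ) (n := {i // OrderDual.toDual (T.dist r i) = a}) using 2
    ext ⟨i, hi⟩ ⟨j, hj⟩
    have hij : T.dist r i = T.dist r j := by
      have := hi.trans hj.symm
      exact this
    have b : ¬ (i ≠ r ∧ j = p i) := by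
      rintro ⟨x, y⟩
      have := (h1 i x).2
      rw [← y] at this
      omega
    simp only [Matrix.toSquareBlock_def, hN, Matrix.of_apply, if_neg b, sub_zero,
      Matrix.one_apply, Subtype.mk.injEq]
  have hK : (lapR T + Matrix.of fun i j => if i = r ∧ j = r then (1 : ℝ) else 0) = Nᵀ * N := by
    ext i j
    have hdeg : degR T j = (if j ≠ r then 1 else 0) + ∑ c, if c ≠ r ∧ j = p c then 1 else 0 := by
      unfold degR
      simp_rw [adjR_eq T hT r p h1 h2 j]
      rw [Finset.sum_add_distrib]
      congr 1
      by_cases hj : j = r <;> simp [hj]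
    have e : (Nᵀ * N) i j = (if i = j then 1 else 0) - (if j ≠ r ∧ i = p j then 1 else 0)
        - (if i ≠ r ∧ j = p i then 1 else 0)
        + ∑ c, (if c ≠ r ∧ i = p c then 1 else 0) * (if c ≠ r ∧ j = p c then 1 else 0) := by
      simp only [Matrix.mul_apply, Matrix.transpose_apply, hN, Matrix.of_apply, sub_mul, mul_sub,
        Finset.sum_sub_distrib]
      have s1 : ∀ (a : V) (g : V → ℝ), ∑ x, (if x = a then 1 else 0) * g x = g a := by
        intro a g; simp
      have s2 : ∀ (a : V) (g : V → ℝ), ∑ x, g x * (if x = a then 1 else 0) = g a := by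
        intro a g; simp
      rw [s1 i, s1 i, s2 j]
      ring
    rw [e]
    simp only [Matrix.add_apply, lapR, Matrix.of_apply, adjR_eq T hT r p h1 h2 i j, hdeg]
    by_cases hij : i = j
    · subst hij
      have : ∀ c, ((if c ≠ r ∧ i = p c then (1:ℝ) else 0) * (if c ≠ r ∧ i = p c then 1 else 0))
        = if c ≠ r ∧ i = p c then 1 else 0 := by
        intro c; split_ifs <;> simp
      simp_rw [this]
      by_cases hr : i = r
      · simp [hr]
        ring
      · simp [hr]
        ring
    · have : ∀ c, ((if c ≠ r ∧ i = p c then (1:ℝ) else 0) * (if c ≠ r ∧ j = p c then 1 else 0))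
        = 0 := by
        intro c
        by_cases hc : c ≠ r ∧ i = p c
        · rw [if_neg (c := c ≠ r ∧ j = p c), mul_zero]
          rintro ⟨_, b⟩
          exact hij (hc.2.trans b.symm)
        · rw [if_neg hc, zero_mul]
      simp_rw [this]
      have h3 : ¬ (i = r ∧ j = r) := fun h => hij (h.1.trans h.2.symm)
      rw [if_neg hij, if_neg hij, if_neg h3]
      simp
      ring
  rw [hK, Matrix.det_mul, Matrix.det_transpose, hdet, one_mul]

lemma det_M (T : SimpleGraph V) (hT : T.IsTree) :
    (lapR T + Matrix.of fun i (_ : V) => tauR T i).det = 2 * Fintype.card V := by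
  obtain ⟨r⟩ := hT.connected.nonempty
  set K := lapR T + Matrix.of fun i j => if i = r ∧ j = r then (1 : ℝ) else 0 with hKdef
  have hK : K.det = 1 := det_K T hT r
  have hu : IsUnit K.det := by rw [hK]; exact isUnit_one
  set z : V → ℝ := K⁻¹ *ᵥ tauR T with hz
  have hKz : K *ᵥ z = tauR T := by
    rw [hz, Matrix.mulVec_mulVec, Matrix.mul_nonsing_inv _ hu, Matrix.one_mulVec]
  have hcol : ∀ j, ∑ i, K i j = if j = r then 1 else 0 := by
    intro j
    simp only [hKdef, Matrix.add_apply, Finset.sum_add_distrib, Matrix.of_apply]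
    rw [Finset.sum_congr rfl (fun i _ => lap_symm T i j), lap_row]
    by_cases hj : j = r <;> simp [hj]
  have hrow : ∀ i, ∑ j, K i j = if i = r then 1 else 0 := by
    intro j
    simp only [hKdef, Matrix.add_apply, Finset.sum_add_distrib, Matrix.of_apply]
    rw [lap_row]
    by_cases hj : j = r <;> simp [hj]
  have hzr : z r = 2 := by
    rw [← sum_tau T hT, ← hKz]
    simp only [Matrix.mulVec, dotProduct]
    rw [Finset.sum_comm]
    simp_rw [← Finset.sum_mul, hcol]
    simp
  set U : Matrix V (Fin 2) ℝ := Matrix.of fun i a => if a = 0 then 1 else z i with hU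
  set W : Matrix (Fin 2) V ℝ := Matrix.of fun a j => if a = 0 then (if j = r then -1 else 0) else 1
    with hW
  have hfac : (lapR T + Matrix.of fun i (_ : V) => tauR T i) = K * (1 + U * W) := by
    rw [mul_add, mul_one, ← Matrix.mul_assoc]
    ext i j
    have e : (K * U * W) i j = (if i = r ∧ j = r then (-1 : ℝ) else 0) + tauR T i := by
      rw [Matrix.mul_apply, Fin.sum_univ_two]
      have e0 : (K * U) i 0 = if i = r then 1 else 0 := by
        rw [← hrow]; simp [Matrix.mul_apply, hU]
      have e1 : (K * U) i 1 = tauR T i := by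
        rw [← hKz]; simp [Matrix.mul_apply, hU, Matrix.mulVec, dotProduct]
      rw [e0, e1]
      by_cases hi : i = r <;> by_cases hj : j = r <;> simp [hW, hi, hj]
    rw [Matrix.add_apply, Matrix.add_apply, e, hKdef, Matrix.add_apply]
    simp only [Matrix.of_apply]
    by_cases h : i = r ∧ j = r <;> simp [h]
  rw [hfac, Matrix.det_mul, hK, Matrix.det_one_add_mul_comm, Matrix.det_fin_two]
  simp [Matrix.mul_apply, hU, hW, hzr]

lemma lap_sMat_lap (T : SimpleGraph V) (hT : T.IsTree) (i j : V) :
    (lapR T * (sMat T * lapR T)) i j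
      = 2 * tauR T i * tauR T j - (if i = j then 4 * tauR T i else 0) := by
  rw [Matrix.mul_apply]
  simp_rw [sMat_lap T hT]
  have e1 : ∑ x, lapR T i x * (2 * T.dist x j * tauR T j - degR T j)
      = 2 * tauR T j * (dMat T * lapR T) j i := by
    simp only [mul_sub, Finset.sum_sub_distrib, ← Finset.sum_mul, lap_row, zero_mul, sub_zero]
    rw [Matrix.mul_apply, Finset.mul_sum]
    apply Finset.sum_congr rfl
    intro x _
    rw [lap_symm T i x, SimpleGraph.dist_comm]
    simp only [dMat, Matrix.of_apply]
    ring
  rw [e1, dMat_lap T hT]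
  by_cases h : i = j
  · simp [h]; ring
  · simp [h, Ne.symm h]; ring

lemma tau_sMat_lap (T : SimpleGraph V) (hT : T.IsTree) (j : V) :
    ∑ i, tauR T i * (sMat T * lapR T) i j = 2 * Fintype.card V * tauR T j - 4 := by
  simp_rw [sMat_lap T hT, mul_sub, Finset.sum_sub_distrib, ← Finset.sum_mul, sum_tau T hT]
  have := dist_tau T hT j
  have e : ∑ i, tauR T i * (2 * T.dist i j * tauR T j)
      = 2 * tauR T j * ∑ i, (T.dist j i : ℝ) * tauR T i := by
    rw [Finset.mul_sum]
    apply Finset.sum_congr rfl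
    intro x _
    rw [SimpleGraph.dist_comm]
    ring
  rw [e, this]
  have : degR T j = 2 - tauR T j := by simp [tauR]
  rw [this]
  ring

lemma MtSM (T : SimpleGraph V) (hT : T.IsTree) (i j : V) :
    ((lapR T + Matrix.of fun i (_ : V) => tauR T i)ᵀ * sMat T *
      (lapR T + Matrix.of fun i (_ : V) => tauR T i)) i j =
      - (if i = j then 4 * tauR T i else 0) + 2 * tauR T i * tauR T j
      + (2 * Fintype.card V * tauR T i - 4) + (2 * Fintype.card V * tauR T j - 4)
      + 2 * (Fintype.card V - 1 : ℝ) ^ 2 := by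
  have ht : (lapR T).transpose = lapR T := by
    ext a b; exact lap_symm T b a
  have hs : ∀ a b, sMat T a b = sMat T b a := by
    intro a b; simp [sMat, SimpleGraph.dist_comm]
  rw [Matrix.mul_assoc, Matrix.transpose_add, Matrix.add_mul, Matrix.mul_add, Matrix.mul_add,
    Matrix.mul_add, ht]
  simp only [Matrix.add_apply]
  rw [lap_sMat_lap T hT]
  have e1 : ((Matrix.of fun i (_ : V) => tauR T i)ᵀ * (sMat T * lapR T)) i j
      = 2 * Fintype.card V * tauR T j - 4 := by
    rw [← tau_sMat_lap T hT j, Matrix.mul_apply]; rfl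
  have e2 : (lapR T * (sMat T * (Matrix.of fun i (_ : V) => tauR T i))) i j
      = 2 * Fintype.card V * tauR T i - 4 := by
    rw [← tau_sMat_lap T hT i, ← Matrix.mul_assoc, Matrix.mul_apply]
    apply Finset.sum_congr rfl
    intro x _
    rw [mul_comm, Matrix.mul_apply, Matrix.mul_apply]
    simp only [Matrix.of_apply]
    congr 1
    apply Finset.sum_congr rfl
    intro y _
    rw [lap_symm, hs, mul_comm]
  have e3 : ((Matrix.of fun i (_ : V) => tauR T i)ᵀ * (sMat T *
      (Matrix.of fun i (_ : V) => tauR T i))) i j = 2 * (Fintype.card V - 1 : ℝ) ^ 2 := by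
    rw [← tau_sq_tau T hT, Matrix.mul_apply]
    simp [Matrix.mul_apply, sMat]
  rw [e1, e2, e3]
  ring

lemma det_sMat (T : SimpleGraph V) (hT : T.IsTree) (h0 : ∀ v, tauR T v ≠ 0) :
    16 * (sMat T).det = (-4) ^ Fintype.card V
      * (2 * Fintype.card V - 1 - 2 * ∑ v, (tauR T v)⁻¹) * ∏ v, tauR T v := by
  set n : ℝ := (Fintype.card V : ℝ) with hn
  have hn0 : n ≠ 0 := by
    have := hT.connected.nonempty
    rw [hn]
    exact_mod_cast Fintype.card_ne_zero
  set S := ∑ v, (tauR T v)⁻¹ with hS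
  set U : Matrix V (Fin 2) ℝ := Matrix.of fun i a =>
    if a = 0 then -(1/2) - (n/2) * (tauR T i)⁻¹ else
      -(n/2) - ((n-1)^2/2 - 2) * (tauR T i)⁻¹ with hU
  set W : Matrix (Fin 2) V ℝ := Matrix.of fun a j => if a = 0 then tauR T j else 1 with hW
  have hfac : (lapR T + Matrix.of fun i (_ : V) => tauR T i)ᵀ * sMat T *
      (lapR T + Matrix.of fun i (_ : V) => tauR T i)
      = Matrix.diagonal (fun i => (-4) * tauR T i) * (1 + U * W) := by
    ext i j
    rw [MtSM T hT, Matrix.diagonal_mul, Matrix.add_apply, Matrix.mul_apply, Fin.sum_univ_two,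
      Matrix.one_apply]
    simp only [hU, hW, Matrix.of_apply, if_true, one_ne_zero, if_false]
    have := h0 i
    rw [← hn]
    by_cases h : i = j
    · simp only [h, if_true] at *
      field_simp
      ring
    · simp only [h, if_false]
      field_simp
      ring
  have hdet := congrArg Matrix.det hfac
  rw [Matrix.det_mul, Matrix.det_mul, Matrix.det_mul, Matrix.det_transpose, det_M T hT,
    Matrix.det_one_add_mul_comm, Matrix.det_diagonal, Finset.prod_mul_distrib,
    Finset.prod_const, Matrix.det_fin_two] at hdet
  have c : (∑ _i : V, (1:ℝ)) = n := by simp [hn]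
  have a00 : (W * U) 0 0 = -1 - n ^ 2 / 2 := by
    simp only [Matrix.mul_apply, hU, hW, Matrix.of_apply, if_true]
    have : ∀ x, tauR T x * (-(1/2) - (n/2) * (tauR T x)⁻¹) = -(1/2) * tauR T x - n/2 * 1 := by
      intro x; have := h0 x; field_simp
    simp_rw [this, Finset.sum_sub_distrib, ← Finset.mul_sum, sum_tau T hT, c]
    ring
  have a01 : (W * U) 0 1 = -n - ((n-1)^2/2 - 2) * n := by
    simp only [Matrix.mul_apply, hU, hW, Matrix.of_apply, if_true, one_ne_zero, if_false]
    have : ∀ x, tauR T x * (-(n/2) - ((n-1)^2/2 - 2) * (tauR T x)⁻¹)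
        = -(n/2) * tauR T x - ((n-1)^2/2 - 2) * 1 := by
      intro x; have := h0 x; field_simp
    simp_rw [this, Finset.sum_sub_distrib, ← Finset.mul_sum, sum_tau T hT, c]
    ring
  have a10 : (W * U) 1 0 = -n/2 - n/2 * S := by
    simp only [Matrix.mul_apply, hU, hW, Matrix.of_apply, if_true, one_ne_zero, if_false, one_mul]
    rw [Finset.sum_sub_distrib, ← Finset.mul_sum, ← hS]
    simp [← hn]
    ring
  have a11 : (W * U) 1 1 = -n^2/2 - ((n-1)^2/2 - 2) * S := by
    simp only [Matrix.mul_apply, hU, hW, Matrix.of_apply, one_ne_zero, if_false, one_mul]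
    rw [Finset.sum_sub_distrib, ← Finset.mul_sum, ← hS]
    simp [← hn]
    ring
  simp only [Matrix.add_apply, a00, a01, a10, a11, Matrix.one_apply_eq, ← hn] at hdet
  rw [Matrix.one_apply_ne (by decide), Matrix.one_apply_ne (by decide)] at hdet
  have hn2 : n ^ 2 ≠ 0 := pow_ne_zero 2 hn0
  apply mul_left_cancel₀ hn2
  rw [Finset.card_univ] at hdet
  linear_combination 4 * hdet

end treeHelpers

theorem stmt11 {n : ℕ} (T : SimpleGraph (Fin n)) (hT : T.IsTree)
    (hdeg : ∀ v, degr T v ≠ 2) :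
    (Matrix.of fun i j => ((T.dist i j : ℝ)) ^ 2).det
      = (-1 : ℝ) ^ n * (4 : ℝ) ^ ((n : ℤ) - 2)
        * (2 * (n : ℝ) - 1 - 2 * ∑ v, (2 - (degr T v : ℝ))⁻¹)
        * ∏ v, (2 - (degr T v : ℝ)) := by
  classical
  have hd : ∀ v, (degr T v : ℝ) = degR T v := by
    intro v
    unfold degr degR adjR
    rw [Set.ncard_eq_toFinset_card']
    simp [Finset.sum_boole, SimpleGraph.neighborFinset_eq_filter]
  have hτ : ∀ v, (2 - (degr T v : ℝ)) = tauR T v := by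
    intro v; rw [hd]; rfl
  have h0 : ∀ v, tauR T v ≠ 0 := by
    intro v h
    rw [← hτ] at h
    apply hdeg v
    have : (degr T v : ℝ) = 2 := by linarith
    exact_mod_cast this
  have key := det_sMat T hT h0
  simp_rw [hτ]
  rw [Fintype.card_fin] at key
  have e : (-1 : ℝ) ^ n * (4 : ℝ) ^ ((n : ℤ) - 2) = (-4) ^ n / 16 := by
    rw [zpow_sub₀ (by norm_num), zpow_natCast, show (-4 : ℝ) = (-1) * 4 by norm_num, mul_pow]
    norm_num
    ring
  rw [e]
  change (sMat T).det = _
  linear_combination key / 16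

end
end

section
/- Let T be a tree with vertex set {1,...,n}, edge set {e_1,...,e_{n-1}}, and nonzero real edge weights w_1,...,w_{n-1}. Suppose q is a vertex of degree 2 with neighbors p and r, joined to q by the edges e_i = {p,q} and e_j = {q,r}. Then the squared distance matrix Δ of T satisfies det Δ = (-1)^{n-1} 2^{2n-5} (w_i + w_j)² (∏_{s=1}^{n-1} w_s²) (∏_{k ≠ q} τ_k), where τ_k = 2 - δ_k and δ_k is the degree of vertex k. -/
open Finset Matrix

noncomputable section

/-- The determinant of the transformed squared distance matrix. -/
theorem det_core {V : Type*} [Fintype V] [DecidableEq V] (τ x : V → ℝ) (q : V)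
    (hq : τ q = 0) (hτ : ∑ u, τ u = 2) (hx : ∑ u, x u = 0) :
    (Matrix.of fun u v : V => 2 * τ u * τ v - (if u = v then 4 * τ u else 0)
      + (if u = q then x v else 0) + (if v = q then x u else 0)).det
      = -(-4) ^ (Fintype.card V) / 32 * (x q) ^ 2 * ∏ k ∈ univ.erase q, τ k := by
  by_cases h0 : ∃ k, k ≠ q ∧ τ k = 0
  · obtain ⟨k, hkq, hk⟩ := h0
    rw [Finset.prod_eq_zero (Finset.mem_erase.2 ⟨hkq, mem_univ k⟩) hk, mul_zero]
    obtain ⟨m, hm⟩ : ∃ m, τ m ≠ 0 := by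
      by_contra! h
      simp [h] at hτ
    have hmq : m ≠ q := by rintro rfl; exact hm hq
    have hmk : m ≠ k := by rintro rfl; exact hm hk
    rw [← Matrix.exists_mulVec_eq_zero_iff]
    by_cases hxq : x q = 0
    · refine ⟨fun v => 1 - (if v = q then 1 else 0), ?_, ?_⟩
      · intro h
        have := congrFun h m
        simp [hmq] at this
      · ext u
        simp only [Matrix.mulVec, dotProduct, Matrix.of_apply, Pi.zero_apply]
        simp only [mul_sub, mul_one, mul_ite, mul_zero, Finset.sum_sub_distrib, Finset.sum_add_distrib,
          ← Finset.mul_sum, hτ, Finset.sum_ite_eq, Finset.sum_ite_eq', mem_univ, if_true]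
        by_cases huq : u = q <;> simp [huq, hq, hxq, hx] <;> ring
    · refine ⟨fun v => (if v = k then x q else 0) + x k * (1 - (if v = q then 1 else 0)), ?_, ?_⟩
      · intro h
        have h1 := congrFun h m
        have h2 := congrFun h k
        simp [hmq, hmk] at h1
        simp [hkq, h1] at h2
        exact hxq h2
      · ext u
        simp only [Matrix.mulVec, dotProduct, Matrix.of_apply, Pi.zero_apply]
        simp only [mul_add, mul_sub, mul_one, mul_ite, mul_zero, Finset.sum_sub_distrib, Finset.sum_add_distrib,
          ← Finset.mul_sum, ← Finset.sum_mul, hτ, Finset.sum_ite_eq, Finset.sum_ite_eq', mem_univ, if_true]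
        by_cases huq : u = q
        · simp [huq, hq, hx, hk, hkq, hkq.symm, ← Finset.sum_mul]; ring
        · by_cases huk : u = k
          · simp [huk, hq, hx, hk, hkq, hkq.symm, ← Finset.sum_mul]
          · simp [huk, huq, hq, hx, hk, hkq, hkq.symm, ← Finset.sum_mul]
            ring
  · push Not at h0
    set t : V → ℝ := fun u => τ u + if u = q then 1 else 0 with ht
    have ht0 : ∀ u, t u ≠ 0 := by
      intro u
      by_cases h : u = q
      · simp [ht, h, hq]
      · simpa [ht, h] using h0 u h
    let D : Matrix V V ℝ := Matrix.diagonal fun u => -4 * t u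
    let U : Matrix V (Fin 3) ℝ := Matrix.of fun u => ![τ u, if u = q then 1 else 0, x u]
    let W : Matrix (Fin 3) V ℝ := Matrix.of ![fun u => 2 * τ u,
      fun u => (if u = q then 4 else 0) + x u, fun u => if u = q then 1 else 0]
    have hD : D.det = (-4) ^ (Fintype.card V) * ∏ k ∈ univ.erase q, τ k := by
      simp only [D, Matrix.det_diagonal, Finset.prod_mul_distrib, Finset.prod_const, Finset.card_univ]
      congr 1
      rw [← Finset.mul_prod_erase univ t (mem_univ q)]
      simp only [ht, hq, if_true, zero_add, one_mul]
      refine Finset.prod_congr rfl fun k hk => ?_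
      simp [(Finset.mem_erase.1 hk).1]
    have hDu : IsUnit D.det := by
      rw [isUnit_iff_ne_zero]
      simp only [D, Matrix.det_diagonal]
      exact Finset.prod_ne_zero_iff.2 fun u _ => mul_ne_zero (by norm_num) (ht0 u)
    have hDi : D⁻¹ = Matrix.diagonal fun u => (-4 * t u)⁻¹ := by
      apply Matrix.inv_eq_right_inv
      simp only [D, Matrix.diagonal_mul_diagonal]
      rw [← Matrix.diagonal_one]
      congr 1
      ext u
      exact mul_inv_cancel₀ (mul_ne_zero (by norm_num) (ht0 u))
    have hK : (Matrix.of fun u v : V => 2 * τ u * τ v - (if u = v then 4 * τ u else 0)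
      + (if u = q then x v else 0) + (if v = q then x u else 0)) = D + U * W := by
      ext u v
      simp only [D, U, W, Matrix.add_apply, Matrix.mul_apply, Fin.sum_univ_three, Matrix.diagonal_apply,
        Matrix.of_apply, ht]
      by_cases h1 : u = q <;> by_cases h2 : v = q <;> by_cases h3 : u = v <;>
        simp_all <;> ring
    rw [hK, Matrix.det_add_mul _ _ hDu, hD, hDi]
    have key : ∀ (f g : V → ℝ), (∑ u, f u * (-4 * t u)⁻¹ * g u)
        = -(1/4) * (f q * g q) + -(1/4) * ∑ u ∈ univ.erase q, f u * g u / τ u := by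
      intro f g
      rw [← Finset.add_sum_erase univ _ (mem_univ q), Finset.mul_sum]
      congr 1
      · simp [ht, hq]; ring
      · refine Finset.sum_congr rfl fun u hu => ?_
        have := h0 u (Finset.mem_erase.1 hu).1
        simp only [ht, (Finset.mem_erase.1 hu).1, if_false, add_zero]
        field_simp
    have e1 : ∀ g : V → ℝ, ∑ u ∈ univ.erase q, τ u * g u / τ u = ∑ u ∈ univ.erase q, g u := by
      intro g
      refine Finset.sum_congr rfl fun u hu => ?_
      have := h0 u (Finset.mem_erase.1 hu).1
      field_simp
    have sτ : ∑ u ∈ univ.erase q, τ u = 2 := by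
      rw [← hτ, ← Finset.add_sum_erase univ _ (mem_univ q), hq, zero_add]
    have sx : ∑ u ∈ univ.erase q, x u = - x q := by
      have := Finset.add_sum_erase univ x (mem_univ q)
      linarith
    have sq : ∀ (f g : V → ℝ) (c : ℝ), ∑ u ∈ univ.erase q, (if u = q then c else 0) * g u / τ u = 0 := by
      intro f g c
      refine Finset.sum_eq_zero fun u hu => ?_
      simp [(Finset.mem_erase.1 hu).1]
    have entry : ∀ a b, (W * (Matrix.diagonal fun u => (-4 * t u)⁻¹) * U) a b
        = ∑ u, W a u * (-4 * t u)⁻¹ * U u b := by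
      intro a b
      rw [Matrix.mul_apply]
      simp only [Matrix.mul_diagonal]
    set s := ∑ u ∈ univ.erase q, x u * x u / τ u
    have c00 : ∑ u, W 0 u * (-4 * t u)⁻¹ * U u 0 = -1 := by
      rw [key, show (∑ u ∈ univ.erase q, W 0 u * U u 0 / τ u) = 2 * ∑ u ∈ univ.erase q, τ u * τ u / τ u by
        rw [Finset.mul_sum]; refine Finset.sum_congr rfl fun u _ => ?_; change 2 * τ u * τ u / τ u = _; ring, e1, sτ]
      simp [W, U, hq]; norm_num
    have c01 : ∑ u, W 0 u * (-4 * t u)⁻¹ * U u 1 = 0 := by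
      rw [key, show (∑ u ∈ univ.erase q, W 0 u * U u 1 / τ u) = 0 by
        refine Finset.sum_eq_zero fun u hu => ?_
        simp [W, U, (Finset.mem_erase.1 hu).1]]
      simp [W, U, hq]
    have c02 : ∑ u, W 0 u * (-4 * t u)⁻¹ * U u 2 = x q / 2 := by
      rw [key, show (∑ u ∈ univ.erase q, W 0 u * U u 2 / τ u) = 2 * ∑ u ∈ univ.erase q, τ u * x u / τ u by
        rw [Finset.mul_sum]; refine Finset.sum_congr rfl fun u _ => ?_; simp [W, U]; ring, e1, sx]
      simp [W, U, hq]; ring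
    have c10 : ∑ u, W 1 u * (-4 * t u)⁻¹ * U u 0 = x q / 4 := by
      rw [key, show (∑ u ∈ univ.erase q, W 1 u * U u 0 / τ u) = ∑ u ∈ univ.erase q, τ u * x u / τ u by
        refine Finset.sum_congr rfl fun u hu => ?_
        simp [W, U, (Finset.mem_erase.1 hu).1]; ring, e1, sx]
      simp [W, U, hq]; ring
    have c11 : ∑ u, W 1 u * (-4 * t u)⁻¹ * U u 1 = - 1 - x q / 4 := by
      rw [key, show (∑ u ∈ univ.erase q, W 1 u * U u 1 / τ u) = 0 by
        refine Finset.sum_eq_zero fun u hu => ?_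
        simp [W, U, (Finset.mem_erase.1 hu).1]]
      simp [W, U]; ring
    have c20 : ∑ u, W 2 u * (-4 * t u)⁻¹ * U u 0 = 0 := by
      rw [key, show (∑ u ∈ univ.erase q, W 2 u * U u 0 / τ u) = 0 by
        refine Finset.sum_eq_zero fun u hu => ?_
        simp [W, U, (Finset.mem_erase.1 hu).1]]
      simp [W, U, hq]
    have c21 : ∑ u, W 2 u * (-4 * t u)⁻¹ * U u 1 = -1/4 := by
      rw [key, show (∑ u ∈ univ.erase q, W 2 u * U u 1 / τ u) = 0 by
        refine Finset.sum_eq_zero fun u hu => ?_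
        simp [W, U, (Finset.mem_erase.1 hu).1]]
      simp [W, U]; norm_num
    rw [Matrix.det_fin_three]
    simp only [Matrix.add_apply, entry, c00, c01, c02, c10, c11, c20, c21]
    simp
    ring

/-- Linear algebra behind the tree: `ρ e` is the indicator of the side of `a e`. -/
theorem algebra_core {V I : Type*} [Fintype V] [DecidableEq V] [Fintype I] [DecidableEq I]
    (hcard : Fintype.card V = Fintype.card I + 1)
    (a b : I → V) (ρ : I → V → ℤ) (h01 : ∀ e v, ρ e v = 0 ∨ ρ e v = 1)
    (hρ : ∀ e f, ρ e (a f) - ρ e (b f) = if e = f then 1 else 0)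
    (w : I → ℝ) (hw : ∀ e, w e ≠ 0) (d : V → V → ℝ)
    (hd : ∀ u v, d u v = ∑ e, w e * ((ρ e u : ℝ) - ρ e v) ^ 2)
    (τ : V → ℝ) (hτ : ∀ u, τ u = 2 - ∑ e, if a e = u ∨ b e = u then (1 : ℝ) else 0)
    (q : V) (hq : τ q = 0) :
    (Matrix.of fun u v => (d u v) ^ 2).det = -(-4) ^ (Fintype.card V) / 32 *
      (∑ e, if a e = q ∨ b e = q then w e else 0) ^ 2 * (∏ e, (w e) ^ 2) *
      ∏ k ∈ univ.erase q, τ k := by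
  have ha : ∀ e, ρ e (a e) = 1 := by
    intro e; have := hρ e e; have := h01 e (a e); have := h01 e (b e); simp at *; omega
  have hb : ∀ e, ρ e (b e) = 0 := by
    intro e; have := hρ e e; have := h01 e (a e); have := h01 e (b e); simp at *; omega
  have hab : ∀ e, a e ≠ b e := by
    intro e h; have h1 := ha e; rw [h, hb] at h1; omega
  -- incidence matrix
  let B : Matrix V (I ⊕ Unit) ℤ := Matrix.of fun u => Sum.elim
    (fun e => (if a e = u then 1 else 0) - (if b e = u then 1 else 0)) (fun _ => if u = q then 1 else 0)
  let C : Matrix (I ⊕ Unit) V ℤ := Matrix.of (Sum.elim (fun e v => ρ e v - ρ e q) (fun _ _ => 1))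
  have hCB : C * B = 1 := by
    ext x y
    rcases x with e | x <;> rcases y with f | y
    · simp [B, C, Matrix.mul_apply, mul_sub, Matrix.one_apply, Finset.sum_sub_distrib]
      simpa using hρ e f
    · simp [B, C, Matrix.mul_apply]
    · simp [B, C, Matrix.mul_apply]
    · simp [B, C, Matrix.mul_apply]
  have hcard' : Fintype.card (I ⊕ Unit) = Fintype.card V := by simp [hcard]
  have hBC : B * C = 1 := (Matrix.mul_eq_one_comm_of_card_eq _ _ _ hcard').1 hCB
  let φ : V ≃ I ⊕ Unit := Fintype.equivOfCardEq hcard'.symm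
  have hdetB : ((B.submatrix id φ).det) ^ 2 = 1 := by
    have h : C.submatrix φ id * B.submatrix id φ = 1 := by
      have := Matrix.submatrix_mul_equiv C B φ (Equiv.refl V) φ
      rw [hCB] at this
      simpa using this
    have h2 := congrArg Matrix.det h
    rw [Matrix.det_mul, Matrix.det_one] at h2
    have : IsUnit (B.submatrix id φ).det := IsUnit.of_mul_eq_one_right _ h2
    rcases Int.isUnit_iff.1 this with h | h <;> rw [h] <;> norm_num
  let Q : V → I → ℝ := fun u e => (if a e = u then 1 else 0) - (if b e = u then 1 else 0)
  have hQsq : ∀ u e, Q u e ^ 2 = if a e = u ∨ b e = u then 1 else 0 := by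
    intro u e
    have := hab e
    by_cases h1 : a e = u <;> by_cases h2 : b e = u <;> simp [Q, h1, h2]
    exact this (h1.trans h2.symm)
  have hQsum : ∀ (f : V → ℝ) e, ∑ u, f u * Q u e = f (a e) - f (b e) := by
    intro f e
    simp [Q, mul_sub, Finset.sum_sub_distrib]
  let σ : I → V → ℝ := fun e v => 1 - 2 * (ρ e v : ℝ)
  have hσ : ∀ e v, σ e v ^ 2 = 1 := by
    intro e v
    rcases h01 e v with h | h <;> simp [σ, h]; norm_num
  have hc0 : ∀ u v, ∑ e, Q u e * ((ρ e v : ℝ) - ρ e q) = (if u = v then 1 else 0) - if u = q then 1 else 0 := by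
    intro u v
    have := congrFun (congrFun hBC u) v
    simp [B, C, Matrix.mul_apply, Matrix.one_apply] at this
    have h2 := congrArg (Int.cast : ℤ → ℝ) this
    push_cast at h2
    simp only [Q]
    linarith
  have hQσ : ∀ u e, Q u e * σ e u = - (if a e = u ∨ b e = u then 1 else 0) := by
    intro u e
    have := hab e
    by_cases h1 : a e = u <;> by_cases h2 : b e = u
    · exact absurd (h1.trans h2.symm) this
    · subst h1; simp [Q, σ, h2, ha]; norm_num
    · subst h2; simp [Q, σ, h1, hb]
    · simp [Q, h1, h2]
  have hc : ∀ u v, ∑ e, Q u e * σ e v = τ u - if u = v then 2 else 0 := by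
    intro u v
    have h1 := hc0 u v
    have h2 := hc0 u u
    have h3 : ∑ e, Q u e * σ e u = τ u - 2 := by
      rw [hτ]; simp only [hQσ, Finset.sum_neg_distrib]; ring
    have h4 : ∑ e, Q u e * σ e v = ∑ e, Q u e * σ e u + 2 * (∑ e, Q u e * ((ρ e u : ℝ) - ρ e q))
        - 2 * (∑ e, Q u e * ((ρ e v : ℝ) - ρ e q)) := by
      rw [Finset.mul_sum, Finset.mul_sum, ← Finset.sum_add_distrib, ← Finset.sum_sub_distrib]
      refine Finset.sum_congr rfl fun e _ => ?_
      simp only [σ]; ring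
    rw [h4, h3, h1, h2]
    rw [if_pos rfl]
    split_ifs <;> ring
  have hτsum : ∑ u, τ u = 2 := by
    have h1 : ∑ u, ∑ e, Q u e * σ e q = 0 := by
      rw [Finset.sum_comm]
      refine Finset.sum_eq_zero fun e _ => ?_
      have := hQsum (fun _ => σ e q) e
      simp only [sub_self] at this
      rw [← this]
      exact Finset.sum_congr rfl fun u _ => mul_comm _ _
    simp only [hc, Finset.sum_sub_distrib] at h1
    simp at h1
    linarith
  have dsymm : ∀ u v, d u v = d v u := by
    intro u v
    rw [hd, hd]
    exact Finset.sum_congr rfl fun e _ => by ring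
  have dself : ∀ u, d u u = 0 := by intro u; rw [hd]; simp
  have hdiff : ∀ e v, d (a e) v - d (b e) v = σ e v * w e := by
    intro e v
    rw [hd, hd, ← Finset.sum_sub_distrib, Finset.sum_eq_single e]
    · rw [ha, hb]; simp only [σ]; push_cast; ring
    · intro f _ hf
      have := hρ f e
      rw [if_neg hf] at this
      have h : ρ f (a e) = ρ f (b e) := by omega
      rw [h]; ring
    · simp
  -- the Laplacian
  let L : Matrix V V ℝ := Matrix.of fun u v => ∑ e, Q u e * (w e)⁻¹ * Q v e
  let Δ : Matrix V V ℝ := Matrix.of fun u v => (d u v) ^ 2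
  let P : Matrix V V ℝ := Matrix.of fun u v => if u = q ∧ v = q then 1 else 0
  have hLf : ∀ (f : V → ℝ) u, ∑ v, f v * L v u = ∑ e, Q u e * (w e)⁻¹ * (f (a e) - f (b e)) := by
    intro f u
    simp only [L, Matrix.of_apply, Finset.mul_sum]
    rw [Finset.sum_comm]
    refine Finset.sum_congr rfl fun e _ => ?_
    rw [← hQsum f e, Finset.mul_sum]
    exact Finset.sum_congr rfl fun v _ => by ring
  have hLsymm : ∀ u v, L u v = L v u := by
    intro u v
    simp only [L, Matrix.of_apply]
    exact Finset.sum_congr rfl fun e _ => by ring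
  let ω : V → ℝ := fun u => ∑ e, if a e = u ∨ b e = u then w e else 0
  have hLΔ : ∀ u v, (L * Δ) u v = 2 * τ u * d u v - ω u := by
    intro u v
    have h1 : (L * Δ) u v = ∑ z, (d z v) ^ 2 * L z u := by
      rw [Matrix.mul_apply]
      refine Finset.sum_congr rfl fun z _ => ?_
      rw [hLsymm u z]; simp only [Δ, Matrix.of_apply]; ring
    have h2 : ∀ e, Q u e * (w e)⁻¹ * ((d (a e) v) ^ 2 - (d (b e) v) ^ 2)
        = 2 * d u v * (Q u e * σ e v) - (if a e = u ∨ b e = u then w e else 0) := by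
      intro e
      have hdf := hdiff e v
      have hwe := hw e
      have hs := hσ e v
      have h5 : (w e)⁻¹ * ((d (a e) v) ^ 2 - (d (b e) v) ^ 2) = σ e v * (d (a e) v + d (b e) v) := by
        rw [sq_sub_sq, hdf]; field_simp
      rw [mul_assoc, h5]
      by_cases h1 : a e = u <;> by_cases h2 : b e = u
      · exact absurd (h1.trans h2.symm) (hab e)
      · subst h1
        simp only [Q, h2, if_true, if_false, true_or]
        linear_combination (-σ e v) * hdf - w e * hs
      · subst h2
        simp only [Q, h1, if_true, if_false, or_true]
        linear_combination (-σ e v) * hdf - w e * hs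
      · simp [Q, h1, h2]
    rw [h1, hLf (fun z => (d z v) ^ 2)]
    simp only [h2, Finset.sum_sub_distrib, ← Finset.mul_sum, hc]
    by_cases h : u = v
    · subst h; simp [dself, ω]
    · simp [h, ω]; ring
  have hLΔL : ∀ u v, (L * Δ * L) u v = 2 * τ u * τ v - if u = v then 4 * τ u else 0 := by
    intro u v
    rw [Matrix.mul_apply]
    simp only [hLΔ]
    rw [hLf (fun z => 2 * τ u * d u z - ω u)]
    have h2 : ∀ e, Q v e * (w e)⁻¹ * (2 * τ u * d u (a e) - ω u - (2 * τ u * d u (b e) - ω u))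
        = 2 * τ u * (Q v e * σ e u) := by
      intro e
      have hdf := hdiff e u
      have hwe := hw e
      rw [dsymm u, dsymm u]
      field_simp
      linear_combination 2 * Q v e * τ u * hdf
    simp only [h2, ← Finset.mul_sum, hc]
    by_cases h : u = v
    · subst h; simp; ring
    · simp [h, Ne.symm h]
  have hM : ((L + P).det) = ∏ e, (w e)⁻¹ := by
    let Br : Matrix V (I ⊕ Unit) ℝ := B.map (Int.cast : ℤ → ℝ)
    let G : Matrix (I ⊕ Unit) (I ⊕ Unit) ℝ := Matrix.diagonal (Sum.elim (fun e => (w e)⁻¹) (fun _ => 1))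
    have h1 : L + P = Br * G * Brᵀ := by
      ext u v
      rw [Matrix.mul_apply]
      simp only [G, Matrix.mul_diagonal, Fintype.sum_sum_type]
      simp [Br, B, L, P, Q]
      by_cases h1 : u = q <;> by_cases h2 : v = q <;> simp [h1, h2]
    have h2 : L + P = Br.submatrix id φ * G.submatrix φ φ * (Br.submatrix id φ)ᵀ := by
      rw [Matrix.transpose_submatrix, Matrix.submatrix_mul_equiv, Matrix.submatrix_mul_equiv, ← h1]
      simp
    have h3 : (Br.submatrix id φ).det = (((B.submatrix id φ).det : ℤ) : ℝ) := by
      rw [Int.cast_det]; rfl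
    rw [h2, Matrix.det_mul, Matrix.det_mul, Matrix.det_transpose, h3, Matrix.det_submatrix_equiv_self]
    have h4 : (((B.submatrix id φ).det : ℤ) : ℝ) ^ 2 = 1 := by exact_mod_cast hdetB
    simp only [G, Matrix.det_diagonal, Fintype.prod_sum_type]
    simp only [Sum.elim_inl, Sum.elim_inr, Finset.prod_const_one, mul_one]
    linear_combination (∏ e, (w e)⁻¹) * h4
  let x : V → ℝ := fun u => 2 * τ u * d u q - ω u
  have hΔL : ∀ u v, (Δ * L) u v = (L * Δ) v u := by
    intro u v
    rw [Matrix.mul_apply, Matrix.mul_apply]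
    refine Finset.sum_congr rfl fun z _ => ?_
    rw [hLsymm v z]; simp only [Δ, Matrix.of_apply]; rw [dsymm u z]; ring
  have hK : (L + P) * Δ * (L + P) = Matrix.of fun u v : V => 2 * τ u * τ v - (if u = v then 4 * τ u else 0)
      + (if u = q then x v else 0) + (if v = q then x u else 0) := by
    have hPl : ∀ (N : Matrix V V ℝ) u v, (P * N) u v = if u = q then N q v else 0 := by
      intro N u v
      simp only [P, Matrix.mul_apply, Matrix.of_apply]
      by_cases h : u = q <;> simp [h]
    have hPr : ∀ (N : Matrix V V ℝ) u v, (N * P) u v = if v = q then N u q else 0 := by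
      intro N u v
      simp only [P, Matrix.mul_apply, Matrix.of_apply]
      by_cases h : v = q <;> simp [h]
    have : (L + P) * Δ * (L + P) = L * Δ * L + P * (Δ * L) + (L * Δ) * P + P * (Δ * P) := by
      noncomm_ring
    rw [this]
    ext u v
    simp only [Matrix.add_apply, hPl, hPr, hLΔL, hΔL, hLΔ, Matrix.of_apply]
    simp [x, Δ, dself]
  have hxs : ∑ u, x u = 0 := by
    have h1 : ∀ u, x u = ∑ z, (d z q) ^ 2 * L z u := by
      intro u
      have := hLΔ u q
      rw [Matrix.mul_apply] at this
      simp only [x]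
      rw [← this]
      refine Finset.sum_congr rfl fun z _ => ?_
      rw [hLsymm u z]; simp only [Δ, Matrix.of_apply]; ring
    simp only [h1, hLf (fun z => (d z q) ^ 2)]
    rw [Finset.sum_comm]
    refine Finset.sum_eq_zero fun e _ => ?_
    have := hQsum (fun _ => (w e)⁻¹ * ((d (a e) q) ^ 2 - (d (b e) q) ^ 2)) e
    simp only [sub_self] at this
    rw [← this]
    exact Finset.sum_congr rfl fun u _ => by ring
  have hfin := det_core τ x q hq hτsum hxs
  rw [← hK, Matrix.det_mul, Matrix.det_mul, hM] at hfin
  have hxq : x q = - ω q := by simp [x, dself]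
  rw [hxq] at hfin
  have hprod : (∏ e, (w e)⁻¹) * ∏ e, w e = 1 := by
    rw [← Finset.prod_mul_distrib]
    exact Finset.prod_eq_one fun e _ => inv_mul_cancel₀ (hw e)
  rw [Finset.prod_pow]
  change Δ.det = -(-4) ^ (Fintype.card V) / 32 * (ω q) ^ 2 * (∏ e, w e) ^ 2 * _
  generalize (∏ e, (w e)⁻¹) = p1 at *
  generalize (∏ e, w e) = p2 at *
  linear_combination p2 ^ 2 * hfin - (p1 * p2 + 1) * Δ.det * hprod

/-- Telescoping along a trail in a tree. -/
theorem trail_sum {n : ℕ} (T : SimpleGraph (Fin n)) {I : Type*} [Fintype I] [DecidableEq I]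
    (a b : I → Fin n) (w : I → ℝ)
    (hinj : Function.Injective fun i => (s(a i, b i) : Sym2 (Fin n)))
    (hsurj : ∀ e ∈ T.edgeSet, ∃ i, e = s(a i, b i))
    (ρ : I → Fin n → ℤ)
    (hre : ∀ e u v, (T.deleteEdges {s(a e, b e)}).Reachable u v → ρ e u = ρ e v)
    (hab : ∀ e, ρ e (a e) = 1 ∧ ρ e (b e) = 0)
    {u v : Fin n} (p : T.Walk u v) (hp : p.IsTrail) :
    (p.edges.map (fun s => ∑ i, if s = s(a i, b i) then w i else 0)).sum
      = ∑ e, w e * ((ρ e u : ℝ) - ρ e v) ^ 2 := by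
  induction p with
  | nil => simp
  | @cons u x v h p ih =>
    rw [SimpleGraph.Walk.isTrail_cons] at hp
    rw [SimpleGraph.Walk.edges_cons, List.map_cons, List.sum_cons, ih hp.1]
    obtain ⟨f, hf⟩ := hsurj s(u, x) h
    rw [← Finset.sum_add_distrib]
    refine Finset.sum_congr rfl fun e _ => ?_
    by_cases hef : e = f
    · subst hef
      rw [if_pos hf]
      have h1 : ρ e x = ρ e v := by
        apply hre
        exact ⟨p.toDeleteEdge _ (by rw [← hf]; exact hp.2)⟩
      obtain ⟨h2, h3⟩ := hab e
      rw [← h1]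
      rcases Sym2.eq_iff.1 hf with ⟨rfl, rfl⟩ | ⟨rfl, rfl⟩
      · simp [h2, h3]
      · simp [h2, h3]
    · have hne : s(u, x) ≠ s(a e, b e) := by
        intro h'
        exact hef (hinj (h'.symm.trans hf))
      rw [if_neg hne, zero_add]
      have : ρ e u = ρ e x := by
        apply hre
        apply SimpleGraph.Adj.reachable
        rw [SimpleGraph.deleteEdges_adj]
        exact ⟨h, by simpa using hne⟩
      rw [this]

/-- The degree counts incident edges. -/
theorem degr_eq {n : ℕ} (T : SimpleGraph (Fin n)) {I : Type*} [Fintype I] [DecidableEq I]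
    (a b : I → Fin n) (hE : ∀ i, T.Adj (a i) (b i))
    (hinj : Function.Injective fun i => (s(a i, b i) : Sym2 (Fin n)))
    (hsurj : ∀ e ∈ T.edgeSet, ∃ i, e = s(a i, b i)) (u : Fin n) :
    degr T u = (univ.filter fun e => a e = u ∨ b e = u).card := by
  classical
  unfold degr
  rw [← Set.ncard_coe_finset]
  symm
  refine Set.ncard_congr (fun e _ => if a e = u then b e else a e) ?_ ?_ ?_
  · intro e he
    simp only [coe_filter, mem_univ, true_and, Set.mem_setOf_eq] at he
    by_cases h : a e = u
    · subst h; simpa using hE e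
    · have h2 := he.resolve_left h
      subst h2
      simpa [h] using (hE e).symm
  · intro e f he hf h
    simp only [coe_filter, mem_univ, true_and, Set.mem_setOf_eq] at he hf
    apply hinj
    simp only
    rw [Sym2.eq_iff]
    split_ifs at h <;> grind
  · intro x hx
    obtain ⟨e, he⟩ := hsurj s(u, x) hx
    have hne : u ≠ x := T.ne_of_adj hx
    refine ⟨e, ?_, ?_⟩
    · rcases Sym2.eq_iff.1 he with ⟨h1, h2⟩ | ⟨h1, h2⟩ <;> simp [h1]
    · rcases Sym2.eq_iff.1 he with ⟨h1, h2⟩ | ⟨h1, h2⟩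
      · simp [h1, h2]
      · simp [← h1, ← h2, hne.symm]

theorem stmt12 {n : ℕ} (T : SimpleGraph (Fin n)) (hT : T.IsTree)
    (E : Fin (n - 1) → Fin n × Fin n) (w : Fin (n - 1) → ℝ)
    (hw : ∀ i, w i ≠ 0)
    (hE : ∀ i, T.Adj (E i).1 (E i).2)
    (hinj : Function.Injective fun i => (s((E i).1, (E i).2) : Sym2 (Fin n)))
    (hsurj : ∀ e ∈ T.edgeSet, ∃ i, e = s((E i).1, (E i).2))
    (q p r : Fin n) (i j : Fin (n - 1)) (hpr : p ≠ r)
    (hq : degr T q = 2)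
    (hi : s((E i).1, (E i).2) = s(p, q))
    (hj : s((E j).1, (E j).2) = s(q, r)) :
    (sqDistMat T hT.isConnected E w).det
      = (-1 : ℝ) ^ (n - 1) * (2 : ℝ) ^ (2 * (n : ℤ) - 5) * (w i + w j) ^ 2
        * (∏ s, (w s) ^ 2) * ∏ k ∈ Finset.univ.erase q, (2 - (degr T k : ℝ)) := by
  classical
  have hn : 0 < n := q.pos
  let a : Fin (n - 1) → Fin n := fun e => (E e).1
  let b : Fin (n - 1) → Fin n := fun e => (E e).2
  let ρ : Fin (n - 1) → Fin n → ℤ := fun e v =>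
    if (T.deleteEdges {s(a e, b e)}).Reachable (a e) v then 1 else 0
  have hre : ∀ e u v, (T.deleteEdges {s(a e, b e)}).Reachable u v → ρ e u = ρ e v := by
    intro e u v h
    simp only [ρ]
    have : (T.deleteEdges {s(a e, b e)}).Reachable (a e) u ↔
        (T.deleteEdges {s(a e, b e)}).Reachable (a e) v :=
      ⟨fun h' => h'.trans h, fun h' => h'.trans h.symm⟩
    simp only [this]
  have hab : ∀ e, ρ e (a e) = 1 ∧ ρ e (b e) = 0 := by
    intro e
    have hbr := SimpleGraph.isAcyclic_iff_forall_adj_isBridge.1 hT.isAcyclic (hE e)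
    rw [SimpleGraph.isBridge_iff] at hbr
    exact ⟨if_pos (SimpleGraph.Reachable.refl _), if_neg hbr⟩
  have hρ : ∀ e f, ρ e (a f) - ρ e (b f) = if e = f then 1 else 0 := by
    intro e f
    by_cases h : e = f
    · subst h; rw [(hab e).1, (hab e).2]; simp
    · rw [if_neg h, sub_eq_zero]
      apply hre
      apply SimpleGraph.Adj.reachable
      rw [SimpleGraph.deleteEdges_adj]
      refine ⟨hE f, ?_⟩
      intro h'
      exact h (hinj (Set.mem_singleton_iff.1 h').symm)
  have hdeg := degr_eq T a b hE hinj hsurj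
  have hdegR : ∀ u, (2 - (degr T u : ℝ)) = 2 - ∑ e, if a e = u ∨ b e = u then (1 : ℝ) else 0 := by
    intro u
    rw [hdeg u]; simp
  have hmain := algebra_core (by simp; omega) a b ρ
    (by intro e v; simp only [ρ]; split_ifs <;> simp) hρ w hw (wdist T hT.isConnected E w)
    (fun u v => trail_sum T a b w hinj hsurj ρ hre hab _
      (SimpleGraph.Path.isPath _).isTrail)
    (fun u => 2 - (degr T u : ℝ)) hdegR q (by simp [hq])
  have hij : i ≠ j := by
    rintro rfl
    rw [hi] at hj
    rcases Sym2.eq_iff.1 hj with ⟨h1, h2⟩ | ⟨h1, h2⟩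
    · exact hpr (h1.trans h2)
    · exact hpr h1
  have hset : (univ.filter fun e => a e = q ∨ b e = q) = {i, j} := by
    symm
    apply Finset.eq_of_subset_of_card_le
    · intro e he
      simp only [Finset.mem_insert, Finset.mem_singleton] at he
      simp only [Finset.mem_filter, mem_univ, true_and]
      rcases he with rfl | rfl
      · rcases Sym2.eq_iff.1 hi with ⟨h1, h2⟩ | ⟨h1, h2⟩
        · exact Or.inr h2
        · exact Or.inl h1
      · rcases Sym2.eq_iff.1 hj with ⟨h1, h2⟩ | ⟨h1, h2⟩
        · exact Or.inl h1
        · exact Or.inr h2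
    · rw [← hdeg q, hq, Finset.card_pair hij]
  rw [← Finset.sum_filter, hset, Finset.sum_pair hij, Fintype.card_fin] at hmain
  refine hmain.trans ?_
  have hpow : -(-4 : ℝ) ^ n / 32 = (-1 : ℝ) ^ (n - 1) * (2 : ℝ) ^ (2 * (n : ℤ) - 5) := by
    rw [zpow_sub₀ two_ne_zero, _root_.zpow_mul]
    obtain ⟨m, rfl⟩ : ∃ m, n = m + 1 := ⟨n - 1, by omega⟩
    rw [zpow_natCast, show (-4 : ℝ) = (-1) * 4 by norm_num, mul_pow, Nat.add_sub_cancel, pow_succ (-1 : ℝ)]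
    norm_num
    ring
  rw [hpow]

end
end

section
/- Let T be a tree with vertex set {1,...,n}, edge set {e_1,...,e_{n-1}}, and nonzero real edge weights w_1,...,w_{n-1}. If T has at least two vertices of degree 2, then the squared distance matrix Δ of T is singular: det Δ = 0. -/
open Finset Matrix

noncomputable section

lemma wdist_eq_path {n : ℕ} (T : SimpleGraph (Fin n)) (hT : T.IsTree)
    (E : Fin (n - 1) → Fin n × Fin n) (w : Fin (n - 1) → ℝ) {x y : Fin n}
    (p : T.Walk x y) (hp : p.IsPath) :
    wdist T hT.isConnected E w x y = (p.edges.map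
    (fun s => ∑ i : Fin (n-1), if s = s((E i).1, (E i).2) then w i else 0)).sum := by
  unfold wdist
  have h := hT.IsAcyclic.path_unique ((Nonempty.some (hT.isConnected.preconnected x y)).toPath) ⟨p, hp⟩
  rw [h]

/-- Local structure of distances around a vertex with exactly two neighbours. -/
lemma local_dist {n : ℕ} (T : SimpleGraph (Fin n)) (hT : T.IsTree)
    (E : Fin (n - 1) → Fin n × Fin n) (w : Fin (n - 1) → ℝ)
    (hw : ∀ i, w i ≠ 0)
    (hinj : Function.Injective fun i => (s((E i).1, (E i).2) : Sym2 (Fin n)))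
    (hsurj : ∀ e ∈ T.edgeSet, ∃ i, e = s((E i).1, (E i).2))
    (u : Fin n) (hu : degr T u = 2) :
    ∃ (a b : Fin n) (α β : ℝ), α ≠ 0 ∧ β ≠ 0 ∧ ∀ x,
      let d := wdist T hT.isConnected E w x
      (x = u ∧ d u = 0 ∧ d a = α ∧ d b = β) ∨
      (x ≠ u ∧ d a = d u - α ∧ d b = d u + β) ∨
      (x ≠ u ∧ d a = d u + α ∧ d b = d u - β) := by
  obtain ⟨a, b, hab, hN⟩ := Set.ncard_eq_two.mp hu
  have hadj : ∀ y, T.Adj u y ↔ y = a ∨ y = b := by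
    intro y
    rw [← SimpleGraph.mem_neighborSet, hN]; simp
  set W : Sym2 (Fin n) → ℝ :=
    fun s => ∑ i : Fin (n-1), if s = s((E i).1, (E i).2) then w i else 0 with hWdef
  have hW : ∀ y, T.Adj u y → W s(u, y) ≠ 0 := by
    intro y hy
    obtain ⟨i, hi⟩ := hsurj s(u, y) hy
    have : W s(u, y) = w i := by
      simp only [hWdef, hi]
      rw [Finset.sum_eq_single i]
      · simp
      · intro j _ hj
        rw [if_neg]
        intro h
        exact hj (hinj h.symm)
      · simp
    rw [this]; exact hw i
  refine ⟨a, b, W s(u, a), W s(u, b), hW a ((hadj a).2 (Or.inl rfl)), hW b ((hadj b).2 (Or.inr rfl)), ?_⟩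
  intro x d
  obtain ⟨p, hp⟩ := (hT.isConnected.preconnected x u).exists_isPath
  have hdu : d u = (p.edges.map W).sum := wdist_eq_path T hT E w p hp
  -- for each neighbour: either it is the penultimate vertex, or the path extends
  have key : ∀ y, T.Adj u y → (p.penultimate ≠ y ∨ x = u → d y = d u + W s(u, y)) := by
    intro y hy hpen
    have hny : y ∉ p.support := by
      intro hmem
      have hq : (p.takeUntil y hmem).IsPath := hp.takeUntil hmem
      have hune : u ∉ (p.takeUntil y hmem).support := by
        exact SimpleGraph.Walk.endpoint_notMem_support_takeUntil hp hmem hy.ne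
      have hq2 : ((p.takeUntil y hmem).concat hy.symm).IsPath := hq.concat hune hy.symm
      have heq : p = (p.takeUntil y hmem).concat hy.symm := by
        have := hT.IsAcyclic.path_unique ⟨p, hp⟩ ⟨_, hq2⟩
        exact congrArg Subtype.val this
      rcases hpen with h | h
      · apply h
        rw [heq]; simp
      · subst h
        exact hune (SimpleGraph.Walk.start_mem_support _)
    have := wdist_eq_path T hT E w (p.concat hy) (hp.concat hny hy)
    rw [SimpleGraph.Walk.edges_concat] at this
    simp only [List.concat_eq_append, List.map_append, List.sum_append] at this
    rw [hdu]
    simpa [hWdef] using this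
  have key2 : ∀ y, T.Adj u y → x ≠ u → p.penultimate = y → d y = d u - W s(u, y) := by
    intro y hy hx hpen
    have hnil : ¬ p.Nil := SimpleGraph.Walk.not_nil_of_ne hx
    have hl := SimpleGraph.Walk.concat_dropLast (p := p) (p.adj_penultimate hnil)
    have h1 : (p.dropLast).IsPath := hp.dropLast
    have h2 := wdist_eq_path T hT E w p.dropLast h1
    rw [hdu, ← hl, SimpleGraph.Walk.edges_concat]
    subst hpen
    rw [Sym2.eq_swap]
    simp only [List.concat_eq_append, List.map_append, List.sum_append]
    rw [← h2]
    simp [d]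
  have ha := (hadj a).2 (Or.inl rfl)
  have hb := (hadj b).2 (Or.inr rfl)
  by_cases hx : x = u
  · left
    have h0 : d u = 0 := by
      subst hx
      have := wdist_eq_path T hT E w (SimpleGraph.Walk.nil : T.Walk x x) SimpleGraph.Walk.IsPath.nil
      simpa using this
    have h1 := key a ha (Or.inr hx)
    have h2 := key b hb (Or.inr hx)
    rw [h0, zero_add] at h1 h2
    exact ⟨hx, h0, h1, h2⟩
  · right
    have hnil : ¬ p.Nil := SimpleGraph.Walk.not_nil_of_ne hx
    rcases (hadj _).1 (p.adj_penultimate hnil).symm with h | h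
    · left
      exact ⟨hx, key2 a ha hx h, key b hb (Or.inl (by rw [h]; exact hab))⟩
    · right
      exact ⟨hx, key a ha (Or.inl (by rw [h]; exact hab.symm)), key2 b hb hx h⟩

lemma local_vec {n : ℕ} (T : SimpleGraph (Fin n)) (hT : T.IsTree)
    (E : Fin (n - 1) → Fin n × Fin n) (w : Fin (n - 1) → ℝ)
    (hw : ∀ i, w i ≠ 0)
    (hinj : Function.Injective fun i => (s((E i).1, (E i).2) : Sym2 (Fin n)))
    (hsurj : ∀ e ∈ T.edgeSet, ∃ i, e = s((E i).1, (E i).2))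
    (u : Fin n) (hu : degr T u = 2) :
    ∃ (c : Fin n → ℝ) (k : ℝ), sqDistMat T hT.isConnected E w *ᵥ c = (fun _ => k) ∧
      distMat T hT.isConnected E w *ᵥ c = Pi.single u 2 := by
  obtain ⟨a, b, α, β, hα, hβ, h⟩ := local_dist T hT E w hw hinj hsurj u hu
  refine ⟨α⁻¹ • (Pi.single a 1 - Pi.single u 1) + β⁻¹ • (Pi.single b 1 - Pi.single u 1),
    α + β, ?_, ?_⟩
  · funext x
    simp only [Matrix.mulVec_add, Matrix.mulVec_smul, Matrix.mulVec_sub, Matrix.mulVec_single_one,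
      Pi.add_apply, Pi.smul_apply, Pi.sub_apply, Matrix.col_apply, sqDistMat, Matrix.of_apply, smul_eq_mul]
    rcases h x with ⟨_, h1, h2, h3⟩ | ⟨_, h2, h3⟩ | ⟨_, h2, h3⟩
    · rw [h1, h2, h3]; field_simp; ring
    · rw [h2, h3]; field_simp; ring
    · rw [h2, h3]; field_simp; ring
  · funext x
    simp only [Matrix.mulVec_add, Matrix.mulVec_smul, Matrix.mulVec_sub, Matrix.mulVec_single_one,
      Pi.add_apply, Pi.smul_apply, Pi.sub_apply, Matrix.col_apply, distMat, Matrix.of_apply, smul_eq_mul]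
    rcases h x with ⟨hx, h1, h2, h3⟩ | ⟨hx, h2, h3⟩ | ⟨hx, h2, h3⟩
    · rw [h1, h2, h3, hx]; simp; field_simp; norm_num
    · rw [h2, h3, Pi.single_eq_of_ne hx]; field_simp; ring
    · rw [h2, h3, Pi.single_eq_of_ne hx]; field_simp; ring

theorem stmt13 {n : ℕ} (T : SimpleGraph (Fin n)) (hT : T.IsTree)
    (E : Fin (n - 1) → Fin n × Fin n) (w : Fin (n - 1) → ℝ)
    (hw : ∀ i, w i ≠ 0)
    (hE : ∀ i, T.Adj (E i).1 (E i).2)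
    (hinj : Function.Injective fun i => (s((E i).1, (E i).2) : Sym2 (Fin n)))
    (hsurj : ∀ e ∈ T.edgeSet, ∃ i, e = s((E i).1, (E i).2))
    (u v : Fin n) (huv : u ≠ v) (hu : degr T u = 2) (hv : degr T v = 2) :
    (sqDistMat T hT.isConnected E w).det = 0 := by
  obtain ⟨c, k, h1, h2⟩ := local_vec T hT E w hw hinj hsurj u hu
  obtain ⟨c', k', h1', h2'⟩ := local_vec T hT E w hw hinj hsurj v hv
  rw [← Matrix.exists_mulVec_eq_zero_iff]
  by_cases hk : k = 0
  · refine ⟨c, ?_, by rw [h1, hk]; rfl⟩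
    rintro rfl
    have := congrFun h2 u
    simp at this
  · refine ⟨k' • c - k • c', ?_, ?_⟩
    · intro h0
      have h3 : distMat T hT.isConnected E w *ᵥ (k' • c - k • c') = 0 := by
        rw [h0, Matrix.mulVec_zero]
      rw [Matrix.mulVec_sub, Matrix.mulVec_smul, Matrix.mulVec_smul, h2, h2'] at h3
      have := congrFun h3 v
      simp [huv.symm, hk] at this
    · rw [Matrix.mulVec_sub, Matrix.mulVec_smul, Matrix.mulVec_smul, h1, h1']
      funext x
      simp [mul_comm]

end
end

section
/- Let T be a tree with vertex set {1,...,n} and nonzero real edge weights, having no vertex of degree 2. Let Δ be the squared distance matrix and L the weighted Laplacian of T, let τ be the vector with components τ_i = 2 - δ_i, let δ̂ be the vector of weighted degrees, and let τ̂ be the diagonal matrix with diagonal entries 1/τ_1,...,1/τ_n. Then Δ (2τ - L τ̂ δ̂) = (δ̂' τ̂ δ̂) 𝟙, where 𝟙 is the all-ones vector. -/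
open Finset Matrix

noncomputable section

lemma aux_incid {n : ℕ} (T : SimpleGraph (Fin n))
    (E : Fin (n - 1) → Fin n × Fin n)
    (hE : ∀ i, T.Adj (E i).1 (E i).2)
    (hinj : Function.Injective fun i => (s((E i).1, (E i).2) : Sym2 (Fin n)))
    (hsurj : ∀ e ∈ T.edgeSet, ∃ i, e = s((E i).1, (E i).2)) (v : Fin n) :
    degr T v = (univ.filter (fun k => (E k).1 = v ∨ (E k).2 = v)).card := by
  classical
  have h1 : degr T v = (T.incidenceSet v).ncard := by
    unfold degr
    rw [← Nat.card_coe_set_eq, ← Nat.card_coe_set_eq]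
    exact (Nat.card_congr (T.incidenceSetEquivNeighborSet v)).symm
  have h2 : T.incidenceSet v = ((univ.filter (fun k => (E k).1 = v ∨ (E k).2 = v)).image
      (fun i => (s((E i).1, (E i).2) : Sym2 (Fin n))) : Finset (Sym2 (Fin n))) := by
    ext e
    simp only [SimpleGraph.incidenceSet, Set.mem_setOf_eq, coe_image, coe_filter, mem_univ,
      true_and, Set.mem_image, Set.mem_sep_iff]
    constructor
    · rintro ⟨he, hv⟩
      obtain ⟨i, rfl⟩ := hsurj e he
      refine ⟨i, ?_, rfl⟩
      rw [Sym2.mem_iff] at hv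
      tauto
    · rintro ⟨i, hi, rfl⟩
      refine ⟨hE i, ?_⟩
      rw [Sym2.mem_iff]
      tauto
  rw [h1, h2, Set.ncard_coe_finset, card_image_of_injective _ hinj]

lemma aux_lap {n : ℕ}
    (E : Fin (n - 1) → Fin n × Fin n) (w : Fin (n - 1) → ℝ)
    (hne : ∀ i, (E i).1 ≠ (E i).2) (i j : Fin n) :
    lap E w i j = ∑ k, (w k)⁻¹ * (((if i = (E k).1 then 1 else 0) - (if i = (E k).2 then 1 else 0)) *
      ((if j = (E k).1 then 1 else 0) - (if j = (E k).2 then 1 else 0))) := by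
  unfold lap
  simp only [of_apply]
  split_ifs with h
  · subst h
    rw [sum_filter]
    refine sum_congr rfl fun k _ => ?_
    have := hne k
    simp only [eq_comm (a := i)]
    by_cases h1 : (E k).1 = i <;> by_cases h2 : (E k).2 = i <;> simp [h1, h2]
    exact absurd (h1.trans h2.symm) this
  · rw [sum_filter, ← sum_neg_distrib]
    refine sum_congr rfl fun k _ => ?_
    have := hne k
    generalize E k = e at *
    obtain ⟨a, b⟩ := e
    simp only [Prod.mk.injEq] at *
    by_cases h1 : a = i <;> by_cases h2 : b = i <;> by_cases h3 : a = j <;> by_cases h4 : b = j <;>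
      simp_all [eq_comm]

lemma aux_path {n : ℕ} (T : SimpleGraph (Fin n)) (hT : T.IsTree)
    (E : Fin (n - 1) → Fin n × Fin n) (w : Fin (n - 1) → ℝ)
    (hE : ∀ i, T.Adj (E i).1 (E i).2)
    (hinj : Function.Injective fun i => (s((E i).1, (E i).2) : Sym2 (Fin n)))
    (r : Fin n) :
    ∃ c p : Fin (n - 1) → Fin n,
      (∀ k, (c k = (E k).1 ∧ p k = (E k).2) ∨ (c k = (E k).2 ∧ p k = (E k).1)) ∧
      (∀ k, wdist T hT.isConnected E w r (c k) = wdist T hT.isConnected E w r (p k) + w k) ∧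
      Function.Injective c ∧ ∀ k, c k ≠ r := by
  classical
  set P : ∀ v, T.Path r v := fun v => (Nonempty.some (hT.isConnected.preconnected r v)).toPath
    with hP
  have huniq : ∀ v (q : T.Walk r v), q.IsPath → q = (P v : T.Walk r v) := by
    intro v q hq
    have := hT.isAcyclic.path_unique ⟨q, hq⟩ (P v)
    exact congrArg Subtype.val this
  have hadj : ∀ u v, T.Adj u v → v ∈ (P u : T.Walk r u).support →
      u ∉ (P v : T.Walk r v).support := by
    intro u v huv hv
    have h1 := huniq v ((P u : T.Walk r u).takeUntil v hv) ((P u).2.takeUntil hv)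
    rw [← h1]
    exact SimpleGraph.Walk.endpoint_notMem_support_takeUntil (P u).2 hv huv.ne
  have hconc : ∀ u v (h : T.Adj u v), v ∉ (P u : T.Walk r u).support →
      (P u : T.Walk r u).concat h = (P v : T.Walk r v) := by
    intro u v h hv
    exact huniq v _ ((P u).2.concat hv h)
  have hex : ∀ k, ∃ cp : Fin n × Fin n,
      ((cp.1 = (E k).1 ∧ cp.2 = (E k).2) ∨ (cp.1 = (E k).2 ∧ cp.2 = (E k).1)) ∧
      cp.1 ∉ (P cp.2 : T.Walk r cp.2).support := by
    intro k
    by_cases h : (E k).2 ∈ (P (E k).1 : T.Walk r (E k).1).support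
    · exact ⟨((E k).1, (E k).2), Or.inl ⟨rfl, rfl⟩, hadj _ _ (hE k) h⟩
    · exact ⟨((E k).2, (E k).1), Or.inr ⟨rfl, rfl⟩, h⟩
  choose cp hcp1 hcp2 using hex
  have hs : ∀ k, s((cp k).2, (cp k).1) = s((E k).1, (E k).2) := by
    intro k
    rcases hcp1 k with ⟨h1, h2⟩ | ⟨h1, h2⟩
    · rw [h1, h2, Sym2.eq_swap]
    · rw [h1, h2]
  have hA : ∀ k, T.Adj (cp k).2 (cp k).1 := by
    intro k
    rw [← SimpleGraph.mem_edgeSet, hs k]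
    exact hE k
  refine ⟨fun k => (cp k).1, fun k => (cp k).2, hcp1, ?_, ?_, ?_⟩
  · intro k
    have h := hconc _ _ (hA k) (hcp2 k)
    unfold wdist
    change ((P (cp k).1).1.edges.map _).sum =
      ((P (cp k).2).1.edges.map _).sum + _
    rw [← h, SimpleGraph.Walk.edges_concat, List.concat_eq_append, List.map_append, List.sum_append]
    congr 1
    simp only [List.map_cons, List.map_nil, List.sum_cons, List.sum_nil, add_zero]
    rw [hs k, Finset.sum_eq_single k]
    · simp
    · intro b _ hb
      rw [if_neg]
      intro hh
      exact hb (hinj hh).symm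
    · simp
  · intro k l hkl
    simp only at hkl
    have h1 := hconc _ _ (hA k) (hcp2 k)
    have hAl : T.Adj (cp l).2 (cp k).1 := hkl ▸ hA l
    have hl2 : (cp k).1 ∉ (P (cp l).2).1.support := hkl ▸ hcp2 l
    have h2 := hconc _ _ hAl hl2
    have h3 := congrArg SimpleGraph.Walk.penultimate (h1.trans h2.symm)
    simp only [SimpleGraph.Walk.penultimate_concat] at h3
    apply hinj
    simp only
    rw [← hs k, ← hs l, hkl, h3]
  · intro k hk
    apply hcp2 k
    simp only at hk
    rw [hk]
    exact SimpleGraph.Walk.start_mem_support _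

theorem stmt14 {n : ℕ} (T : SimpleGraph (Fin n)) (hT : T.IsTree)
    (E : Fin (n - 1) → Fin n × Fin n) (w : Fin (n - 1) → ℝ)
    (hw : ∀ i, w i ≠ 0)
    (hE : ∀ i, T.Adj (E i).1 (E i).2)
    (hinj : Function.Injective fun i => (s((E i).1, (E i).2) : Sym2 (Fin n)))
    (hsurj : ∀ e ∈ T.edgeSet, ∃ i, e = s((E i).1, (E i).2))
    (hdeg : ∀ v, degr T v ≠ 2) :
    sqDistMat T hT.isConnected E w *ᵥ
        ((2 : ℝ) • (fun v => 2 - (degr T v : ℝ))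
          - lap E w *ᵥ (Matrix.diagonal (fun v => (2 - (degr T v : ℝ))⁻¹) *ᵥ wdeg E w))
      = fun _ => wdeg E w ⬝ᵥ (Matrix.diagonal (fun v => (2 - (degr T v : ℝ))⁻¹) *ᵥ wdeg E w) := by
  classical
  funext r
  obtain ⟨c, p, hcp, hf, hcinj, hcr⟩ := aux_path T hT E w hE hinj r
  set x : Fin n → ℝ := Matrix.diagonal (fun v => (2 - (degr T v : ℝ))⁻¹) *ᵥ wdeg E w with hx
  have hxv : ∀ v, wdeg E w v = (2 - (degr T v : ℝ)) * x v := by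
    intro v
    have : (2 - (degr T v : ℝ)) ≠ 0 := by
      intro h
      apply hdeg v
      have : (degr T v : ℝ) = 2 := by linarith
      exact_mod_cast this
    rw [hx, mulVec_diagonal]
    field_simp
  set f : Fin n → ℝ := fun v => wdist T hT.isConnected E w r v with hfdef
  have hfr : f r = 0 := by
    have : ((Nonempty.some (hT.isConnected.preconnected r r)).toPath : T.Path r r)
        = SimpleGraph.Path.nil := SimpleGraph.Path.loop_eq _
    simp only [hfdef]
    unfold wdist
    rw [this]
    simp
  -- incidence sums
  have hne : ∀ k, (E k).1 ≠ (E k).2 := fun k => (hE k).ne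
  have hinc : ∀ (g : Fin (n-1) → ℝ) (h : Fin n → ℝ),
      ∑ v, h v * ∑ k ∈ univ.filter (fun k => (E k).1 = v ∨ (E k).2 = v), g k
        = ∑ k, g k * (h (c k) + h (p k)) := by
    intro g h
    have : ∀ v, h v * ∑ k ∈ univ.filter (fun k => (E k).1 = v ∨ (E k).2 = v), g k
        = ∑ k, ((if c k = v then g k * h v else 0) + (if p k = v then g k * h v else 0)) := by
      intro v
      rw [sum_filter, mul_sum]
      refine sum_congr rfl fun k _ => ?_
      have := hne k
      rcases hcp k with ⟨h1, h2⟩ | ⟨h1, h2⟩ <;> rw [h1, h2] <;>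
        by_cases h1 : (E k).1 = v <;> by_cases h2 : (E k).2 = v <;> simp [h1, h2, mul_comm] <;>
        exact absurd (h1.trans h2.symm) this
    rw [sum_congr rfl fun v _ => this v, sum_comm]
    refine sum_congr rfl fun k _ => ?_
    rw [sum_add_distrib]
    simp [mul_add]
  have hwd : ∀ h : Fin n → ℝ, ∑ v, h v * wdeg E w v = ∑ k, w k * (h (c k) + h (p k)) :=
    fun h => hinc w h
  have hdg : ∀ h : Fin n → ℝ, ∑ v, h v * (degr T v : ℝ) = ∑ k, (h (c k) + h (p k)) := by
    intro h
    have := hinc (fun _ => 1) h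
    simp only [sum_const, nsmul_eq_mul, mul_one, one_mul] at this
    rw [← this]
    exact sum_congr rfl fun v _ => by rw [aux_incid T E hE hinj hsurj v]
  have himg : univ.image c = univ.erase r := by
    apply eq_of_subset_of_card_le
    · intro v hv
      obtain ⟨k, -, rfl⟩ := mem_image.1 hv
      simp [hcr k]
    · rw [card_image_of_injective _ hcinj, card_erase_of_mem (mem_univ r)]
      simp
  have hsum : ∀ h : Fin n → ℝ, h r = 0 → ∑ v, h v = ∑ k, h (c k) := by
    intro h h0
    rw [← add_sum_erase univ h (mem_univ r), ← himg, sum_image (fun a _ b _ hab => hcinj hab), h0,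
      zero_add]
  have hlap : ∀ h : Fin n → ℝ, ∑ v, h v * (lap E w *ᵥ x) v =
      ∑ k, (w k)⁻¹ * ((h (c k) - h (p k)) * (x (c k) - x (p k))) := by
    intro h
    have h1 : ∀ v, h v * (lap E w *ᵥ x) v = ∑ k, (w k)⁻¹ * ((x (E k).1 - x (E k).2) *
        (((if v = (E k).1 then 1 else 0) - (if v = (E k).2 then 1 else 0)) * h v)) := by
      intro v
      simp only [mulVec, dotProduct]
      simp_rw [aux_lap E w hne, sum_mul]
      rw [sum_comm, mul_sum]
      refine sum_congr rfl fun k _ => ?_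
      have : x (E k).1 - x (E k).2 =
          ∑ j, ((if j = (E k).1 then 1 else 0) - (if j = (E k).2 then 1 else 0)) * x j := by
        simp [sub_mul]
      rw [this, sum_mul, mul_sum, mul_sum]
      exact sum_congr rfl fun j _ => by ring
    rw [sum_congr rfl fun v _ => h1 v, sum_comm]
    refine sum_congr rfl fun k _ => ?_
    rw [← mul_sum, ← mul_sum]
    have : ∑ v, ((if v = (E k).1 then (1:ℝ) else 0) - (if v = (E k).2 then 1 else 0)) * h v
        = h (E k).1 - h (E k).2 := by simp [sub_mul]
    rw [this]
    rcases hcp k with ⟨h1, h2⟩ | ⟨h1, h2⟩ <;> rw [h1, h2] <;> ring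
  have hL : (sqDistMat T hT.isConnected E w *ᵥ
      ((2 : ℝ) • (fun v => 2 - (degr T v : ℝ)) - lap E w *ᵥ x)) r
      = 2 * (2 * ∑ v, f v ^ 2 - ∑ v, f v ^ 2 * (degr T v : ℝ))
        - ∑ v, f v ^ 2 * (lap E w *ᵥ x) v := by
    rw [mulVec, dotProduct]
    simp only [sqDistMat, of_apply, Pi.sub_apply, Pi.smul_apply, smul_eq_mul]
    rw [mul_sum, ← sum_sub_distrib, mul_sum, ← sum_sub_distrib]
    exact sum_congr rfl fun j _ => by simp only [hfdef]; ring
  have hR : wdeg E w ⬝ᵥ x = ∑ k, w k * (x (c k) + x (p k)) := by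
    rw [← hwd x, dotProduct]
    exact sum_congr rfl fun j _ => by ring
  -- the two expressions for `∑ f δ̂`
  have hM : ∑ k, w k * (f (c k) + f (p k)) = 2 * ∑ k, f (c k) * x (c k)
      - ∑ k, (f (c k) * x (c k) + f (p k) * x (p k)) := by
    rw [← hwd f, ← hdg (fun v => f v * x v), ← hsum (fun v => f v * x v) (by simp [hfr]), mul_sum,
      ← sum_sub_distrib]
    exact sum_congr rfl fun j _ => by rw [hxv]; ring
  rw [hL, hR, hlap (fun v => f v ^ 2), hdg (fun v => f v ^ 2), hsum (fun v => f v ^ 2) (by simp [hfr])]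
  rw [← sub_eq_zero]
  rw [← sub_eq_zero] at hM
  have key : ∀ k, w k = f (c k) - f (p k) := fun k => by
    have := hf k
    simp only [hfdef]; linarith
  have hM2 := congrArg (fun z : ℝ => 2 * z) hM
  simp only [mul_zero] at hM2
  refine Eq.trans ?_ hM2
  simp only [mul_sum, ← sum_sub_distrib]
  refine sum_congr rfl fun k _ => ?_
  have h1 : (w k)⁻¹ * ((f (c k) ^ 2 - f (p k) ^ 2) * (x (c k) - x (p k)))
      = (f (c k) + f (p k)) * (x (c k) - x (p k)) := by
    have h2 : f (c k) = f (p k) + w k := by rw [key k]; ring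
    rw [h2]
    have := hw k
    field_simp
    ring
  rw [h1, key k]
  ring

end
end

section
/- Let T be a tree with vertex set {1,...,n}, edge set {e_1,...,e_{n-1}}, and nonzero real edge weights w_1,...,w_{n-1}, having no vertex of degree 2. Let Δ be the squared distance matrix of T. Then the sum of all cofactors of Δ equals (-1)^{n-1} 2^{2n-3} (∏_{k=1}^{n-1} w_k²) (∏_{i=1}^n τ_i), where τ_i = 2 - δ_i and δ_i is the degree of vertex i. -/
open Finset Matrix

noncomputable section

/-! ### Matrix part -/

theorem aux_cof {m : ℕ} (A : Matrix (Fin (m+1)) (Fin (m+1)) ℝ)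
    (Q : Matrix (Fin (m+1)) (Fin m) ℤ) (R : Matrix (Fin m) (Fin (m+1)) ℤ)
    (hRQ : R * Q = 1) (hR : ∀ e, R e 0 = 0) (hQ : ∀ e, ∑ v, Q v e = 0) :
    ((Q.map (Int.cast : ℤ → ℝ))ᵀ * A * (Q.map (Int.cast : ℤ → ℝ))).det
      = ∑ i, ∑ j, A.adjugate i j := by
  let M : Matrix (Fin (m+1)) (Fin (m+1)) ℤ :=
    Matrix.of fun v => Fin.cons (if v = 0 then 1 else 0) (Q v)
  let N : Matrix (Fin (m+1)) (Fin (m+1)) ℤ :=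
    Matrix.of (Fin.cons (fun _ => 1) R)
  have hN0 : ∀ v, N 0 v = 1 := fun _ => rfl
  have hNs : ∀ i v, N (Fin.succ i) v = R i v := fun _ _ => rfl
  have hNM : N * M = 1 := by
    ext i j
    refine Fin.cases ?_ (fun i => ?_) i <;> refine Fin.cases ?_ (fun j => ?_) j
    · simp [hN0, M, Matrix.mul_apply]
    · simp [hN0, M, Matrix.mul_apply, hQ, (Fin.succ_ne_zero _).symm]
    · simp [hNs, M, Matrix.mul_apply, hR, Fin.succ_ne_zero]
    · have := congrFun (congrFun hRQ i) j
      rw [Matrix.mul_apply] at this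
      simp [hNs, M, Matrix.mul_apply, this, Matrix.one_apply, Fin.succ_inj]
  have hdet : M.det * M.det = 1 := by
    have h := congrArg Matrix.det hNM
    rw [Matrix.det_mul, Matrix.det_one] at h
    rcases Int.isUnit_iff.1 (IsUnit.of_mul_eq_one _ ((mul_comm _ _).trans h)) with h | h <;> simp [h]
  have hadj : M.adjugate = M.det • N := by
    calc M.adjugate = N * M * M.adjugate := by rw [hNM, Matrix.one_mul]
      _ = N * (M * M.adjugate) := by rw [Matrix.mul_assoc]
      _ = M.det • N := by rw [Matrix.mul_adjugate, Matrix.mul_smul, Matrix.mul_one]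
  let M' : Matrix (Fin (m+1)) (Fin (m+1)) ℝ := M.map (Int.cast : ℤ → ℝ)
  have hdet' : M'.det = (M.det : ℝ) := ((Int.castRingHom ℝ).map_det M).symm
  have hadj' : ∀ v, M'.adjugate 0 v = (M.det : ℝ) := by
    intro v
    have : M'.adjugate = M.adjugate.map (Int.cast : ℤ → ℝ) :=
      ((Int.castRingHom ℝ).map_adjugate M).symm
    rw [this, hadj]
    rw [Matrix.map_apply, Matrix.smul_apply, hN0, smul_eq_mul, mul_one]
  have hsub : (M'ᵀ * A * M').adjugate 0 0 =
      ((Q.map (Int.cast : ℤ → ℝ))ᵀ * A * (Q.map (Int.cast : ℤ → ℝ))).det := by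
    rw [Matrix.adjugate_fin_succ_eq_det_submatrix]
    simp only [Fin.val_zero, add_zero, pow_zero, one_mul]
    congr 1
  rw [← hsub, Matrix.adjugate_mul_distrib, Matrix.adjugate_mul_distrib, Matrix.mul_apply]
  have hT : ∀ v, (M'ᵀ).adjugate v 0 = (M.det : ℝ) := by
    intro v
    rw [← Matrix.adjugate_transpose, Matrix.transpose_apply, hadj']
  have hd : (M.det : ℝ) * M.det = 1 := by exact_mod_cast hdet
  simp only [Matrix.mul_apply, hadj', hT]
  simp only [Finset.mul_sum]
  refine Finset.sum_congr rfl fun i _ => Finset.sum_congr rfl fun j _ => ?_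
  linear_combination (A.adjugate i j) * hd

theorem aux_diag {n : ℕ} (t : Fin n → ℝ) (ht : ∀ v, t v ≠ 0) :
    ∑ i, ∑ j, (Matrix.diagonal fun v => (t v)⁻¹).adjugate i j
      = (∏ v, (t v)⁻¹) * ∑ v, t v := by
  have h : (Matrix.diagonal fun v => (t v)⁻¹).adjugate
      = (∏ v, (t v)⁻¹) • Matrix.diagonal t := by
    have h1 : (Matrix.diagonal t) * (Matrix.diagonal fun v => (t v)⁻¹) = 1 := by
      rw [Matrix.diagonal_mul_diagonal]
      simp [ht]
    calc _ = (Matrix.diagonal t) * (Matrix.diagonal fun v => (t v)⁻¹)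
            * (Matrix.diagonal fun v => (t v)⁻¹).adjugate := by rw [h1, Matrix.one_mul]
      _ = _ := by
        rw [Matrix.mul_assoc, Matrix.mul_adjugate, Matrix.det_diagonal]; simp
  rw [h]
  simp [Matrix.diagonal_apply, Finset.mul_sum]

/-! ### Abstract cut structure -/

/-- signed incidence -/
def auxQ {m : ℕ} (E : Fin m → Fin (m+1) × Fin (m+1)) : Matrix (Fin (m+1)) (Fin m) ℤ :=
  Matrix.of fun v e => (if v = (E e).1 then 1 else 0) - (if v = (E e).2 then 1 else 0)

theorem auxQ_sum {m : ℕ} (E : Fin m → Fin (m+1) × Fin (m+1)) (e : Fin m)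
    (F : Fin (m+1) → ℝ) : ∑ v, F v * (auxQ E v e : ℝ) = F (E e).1 - F (E e).2 := by
  simp [auxQ, mul_sub, Finset.sum_sub_distrib]

theorem aux_main {m : ℕ} (E : Fin m → Fin (m+1) × Fin (m+1)) (w : Fin m → ℝ)
    (s : Fin m → Fin (m+1) → ℤ) (hw : ∀ i, w i ≠ 0)
    (h1 : ∀ e, s e (E e).1 = 1) (h2 : ∀ e, s e (E e).2 = 0)
    (h3 : ∀ e f, f ≠ e → s e (E f).1 = s e (E f).2)
    (hs : ∀ e v, s e v = 0 ∨ s e v = 1)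
    (D : Fin (m+1) → Fin (m+1) → ℝ)
    (hD : ∀ u v, D u v = ∑ e, w e * ((s e u : ℝ) - s e v)^2)
    (δ : Fin (m+1) → ℝ)
    (hδ : ∀ v, δ v = ∑ f, (auxQ E v f : ℝ)^2)
    (hcnt : ∀ v x, v ≠ x → ∑ f, (auxQ E v f : ℝ)^2 * ((s f v : ℝ) - s f x)^2 = 1)
    (hδ2 : ∀ v, δ v ≠ 2) :
    ∑ i, ∑ j, (Matrix.of fun u v => (D u v)^2).adjugate i j
      = (-1 : ℝ) ^ m * (2 : ℝ) ^ (2 * ((m+1 : ℕ) : ℤ) - 3)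
        * (∏ k, (w k) ^ 2) * ∏ v, (2 - δ v) := by
  have hne : ∀ e, (E e).1 ≠ (E e).2 := by
    intro e h
    have := h1 e
    rw [h, h2] at this
    exact absurd this (by norm_num)
  set A : Matrix (Fin (m+1)) (Fin (m+1)) ℝ := Matrix.of fun u v => (D u v)^2 with hA
  set t : Fin (m+1) → ℝ := fun v => 2 - δ v with ht
  have ht0 : ∀ v, t v ≠ 0 := fun v => sub_ne_zero.2 (hδ2 v).symm
  set Q : Matrix (Fin (m+1)) (Fin m) ℝ := (auxQ E).map (Int.cast : ℤ → ℝ) with hQdef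
  let R : Matrix (Fin m) (Fin (m+1)) ℤ := Matrix.of fun e v => s e v - s e 0
  have hRQ : R * auxQ E = 1 := by
    ext e f
    have : (R * auxQ E) e f = s e (E f).1 - s e (E f).2 := by
      simp [R, Matrix.mul_apply, auxQ, mul_sub, Finset.sum_sub_distrib]
    rw [this, Matrix.one_apply]
    split_ifs with h
    · subst h; rw [h1, h2]; norm_num
    · rw [h3 e f (Ne.symm h)]; ring
  have hR : ∀ e, R e 0 = 0 := by intro e; simp [R]
  have hQ0 : ∀ e, ∑ v, auxQ E v e = 0 := by
    intro e; simp [auxQ, Finset.sum_sub_distrib]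
  have c1 := aux_cof A (auxQ E) R hRQ hR hQ0
  have c2 := aux_cof (Matrix.diagonal fun v => (t v)⁻¹) (auxQ E) R hRQ hR hQ0
  rw [aux_diag t ht0] at c2
  rw [← hQdef] at c1 c2
  -- sum of t
  have hsumt : ∑ v, t v = 2 := by
    have : ∑ v, δ v = 2 * m := by
      simp only [hδ]
      rw [Finset.sum_comm]
      have : ∀ f, ∑ v, (auxQ E v f : ℝ)^2 = 2 := by
        intro f
        have := auxQ_sum E f (fun v => (auxQ E v f : ℝ))
        simp only [← sq] at this
        rw [this]
        simp [auxQ, hne, (hne _).symm]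
        norm_num
      simp [this, mul_comm]
    simp only [ht, Finset.sum_sub_distrib, this]
    simp
    ring
  -- phi
  set φ : Fin m → Fin (m+1) → ℝ := fun e v => 1 - 2 * (s e v : ℝ) with hφ
  let H : Matrix (Fin m) (Fin m) ℝ := Matrix.of fun e f => -(φ e (E f).1 * φ f (E e).2)
  have hφ1 : ∀ e, φ e (E e).1 = -1 := by intro e; simp [hφ, h1]; norm_num
  have hφ2 : ∀ e, φ e (E e).2 = 1 := by intro e; simp [hφ, h2]
  have hφ3 : ∀ e f, f ≠ e → φ e (E f).1 = φ e (E f).2 := by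
    intro e f h; simp [hφ, h3 e f h]
  have hsq : ∀ e v, (s e v : ℝ)^2 = s e v := by
    intro e v; rcases hs e v with h | h <;> simp [h]
  -- differences of distances
  have hDd : ∀ e v, D (E e).1 v - D (E e).2 v = w e * φ e v := by
    intro e v
    rw [hD, hD, ← Finset.sum_sub_distrib, Finset.sum_eq_single e]
    · rw [h1, h2]; simp only [hφ]; push_cast; ring
    · intro f _ hf; rw [h3 f e hf.symm]; ring
    · simp
  have hDs : ∀ u v, D u v = D v u := by
    intro u v; rw [hD, hD]; exact Finset.sum_congr rfl fun e _ => by ring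
  have hD0 : ∀ u, D u u = 0 := by intro u; rw [hD]; simp
  have hQA : Qᵀ * A * Q = (-2 : ℝ) • (Matrix.diagonal w * H * Matrix.diagonal w) := by
    ext e f
    have e1 : (Qᵀ * A * Q) e f = (D (E e).1 (E f).1)^2 - (D (E e).2 (E f).1)^2
        - ((D (E e).1 (E f).2)^2 - (D (E e).2 (E f).2)^2) := by
      rw [Matrix.mul_apply]
      have : ∀ v, (Qᵀ * A) e v = (D (E e).1 v)^2 - (D (E e).2 v)^2 := by
        intro v
        rw [Matrix.mul_apply, ← auxQ_sum E e (fun u => (D u v)^2)]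
        exact Finset.sum_congr rfl fun u _ => by simp [hQdef, hA, mul_comm]
      simp only [this]
      exact auxQ_sum E f (fun v => (D (E e).1 v)^2 - (D (E e).2 v)^2)
    rw [e1]
    simp only [Matrix.smul_apply, Matrix.mul_diagonal, Matrix.diagonal_mul, smul_eq_mul, H,
      Matrix.of_apply]
    by_cases hef : f = e
    · subst hef
      have a1 := hDd f (E f).2
      rw [hφ2, hD0] at a1
      rw [hD0, hD0, hφ1, hφ2, hDs (E f).2 (E f).1]
      have : D (E f).1 (E f).2 = w f := by linarith
      rw [this]; ring
    · have a1 := hDd e (E f).1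
      have a2 := hDd e (E f).2
      have a3 := hDd f (E e).2
      rw [hDs (E f).1, hDs (E f).2] at a3
      rw [← hφ3 e f hef] at a2
      have b1 : D (E e).1 (E f).1 = D (E e).2 (E f).1 + w e * φ e (E f).1 := by linarith
      have b2 : D (E e).1 (E f).2 = D (E e).2 (E f).2 + w e * φ e (E f).1 := by linarith
      have b3 : D (E e).2 (E f).1 = D (E e).2 (E f).2 + w f * φ f (E e).2 := by linarith
      rw [b1, b2, b3]; ring
  -- the key identity
  have hHQ : ∀ e v, ∑ f, H e f * (auxQ E v f : ℝ) = - φ e v * t v := by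
    intro e v
    obtain ⟨x, hx, hxv, hxe⟩ : ∃ x, v ≠ x ∧ (s e x : ℝ) = 1 - s e v ∧
        (∀ f, f ≠ e → s f x = s f (E e).2) := by
      rcases hs e v with h | h
      · refine ⟨(E e).1, ?_, ?_, fun f hf => h3 f e hf.symm⟩
        · rintro rfl; rw [h1] at h; norm_num at h
        · simp [h, h1]
      · refine ⟨(E e).2, ?_, ?_, fun f hf => rfl⟩
        · rintro rfl; rw [h2] at h; norm_num at h
        · simp [h, h2]
    have key : ∀ f, H e f * (auxQ E v f : ℝ)
        = φ e v * ((auxQ E v f : ℝ)^2 - 2 * ((auxQ E v f : ℝ)^2 * ((s f v : ℝ) - s f x)^2)) := by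
      intro f
      by_cases hv1 : v = (E f).1
      · have q : (auxQ E v f : ℝ) = 1 := by simp [auxQ, hv1, hne]
        rw [q]
        by_cases hef : f = e
        · subst hef
          have : (s f v : ℝ) = 1 := by rw [hv1, h1]; simp
          simp only [H, Matrix.of_apply, hφ1, hφ2, hxv, this]
          simp only [hφ, this]; norm_num
        · have : (s f v : ℝ) = 1 := by rw [hv1, h1]; simp
          simp only [H, Matrix.of_apply, ← hv1, this]
          have h5 := hsq f (E e).2
          rw [hxe f hef]
          simp only [hφ]
          linear_combination (2 - 4 * (s e v : ℝ)) * h5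
      · by_cases hv2 : v = (E f).2
        · have q : (auxQ E v f : ℝ) = -1 := by simp [auxQ, hv2, (hne _).symm]
          rw [q]
          have h6 : (s f v : ℝ) = 0 := by rw [hv2, h2]; simp
          by_cases hef : f = e
          · subst hef
            simp only [H, Matrix.of_apply, hφ1, hφ2, hxv, h6]
            simp only [hφ, h6]; norm_num
          · simp only [H, Matrix.of_apply, hφ3 e f hef, ← hv2, h6]
            have h5 := hsq f (E e).2
            rw [hxe f hef]
            simp only [hφ]
            linear_combination (2 - 4 * (s e v : ℝ)) * h5
        · have q : (auxQ E v f : ℝ) = 0 := by simp [auxQ, hv1, hv2]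
          rw [q]; ring
    simp only [key]
    rw [← Finset.mul_sum, Finset.sum_sub_distrib, ← Finset.mul_sum, hcnt v x hx, ← hδ]
    simp only [ht]; ring
  have hHG : H * (Qᵀ * (Matrix.diagonal fun v => (t v)⁻¹) * Q) = (2 : ℝ) • 1 := by
    rw [← Matrix.mul_assoc, ← Matrix.mul_assoc]
    ext e g
    rw [Matrix.mul_apply]
    have : ∀ v, (H * Qᵀ * Matrix.diagonal fun v => (t v)⁻¹) e v = - φ e v := by
      intro v
      rw [Matrix.mul_diagonal, Matrix.mul_apply]
      have := hHQ e v
      simp only [hQdef, Matrix.transpose_apply, Matrix.map_apply]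
      rw [this]
      field_simp [ht0 v]
    simp only [this]
    have h7 := auxQ_sum E g (fun v => - φ e v)
    simp only [hQdef, Matrix.map_apply]
    rw [h7]
    by_cases h : g = e
    · subst h; rw [hφ1, hφ2]; simp; norm_num
    · rw [hφ3 e g h]; simp [Matrix.one_apply, Ne.symm h]
  have d1 := congrArg Matrix.det hQA
  have d2 := congrArg Matrix.det hHG
  rw [Matrix.det_mul, c2, hsumt, Matrix.det_smul, Matrix.det_one] at d2
  rw [c1, Matrix.det_smul, Matrix.det_mul, Matrix.det_mul, Matrix.det_diagonal] at d1
  rw [d1]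
  have hP : (∏ v, (t v)⁻¹) * ∏ v, t v = 1 := by
    rw [← Finset.prod_mul_distrib]; exact Finset.prod_eq_one fun v _ => inv_mul_cancel₀ (ht0 v)
  have hH : H.det * 2 = 2 ^ m * ∏ v, t v := by
    simp only [Fintype.card_fin, mul_one] at d2
    linear_combination (∏ v, t v) * d2 - H.det * 2 * hP
  have hz : (2 : ℝ) ^ (2 * ((m+1 : ℕ) : ℤ) - 3) * 2 = 2 ^ m * 2 ^ m := by
    have : (2 * ((m+1 : ℕ) : ℤ) - 3) = ((m + m : ℕ) : ℤ) - 1 := by push_cast; ring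
    rw [this, zpow_sub₀ (by norm_num), zpow_natCast, pow_add]; simp
  have hn2 : (-2 : ℝ)^m = (-1)^m * 2^m := by rw [← mul_pow]; norm_num
  rw [Fintype.card_fin, hn2, Finset.prod_pow]
  linear_combination (-1)^m * 2^m * (∏ k, w k)^2 / 2 * hH - (-1)^m * (∏ k, w k)^2 * (∏ v, t v) / 2 * hz

/-! ### Graph part -/

open Classical in
/-- side of the cut -/
def auxS {m : ℕ} (T : SimpleGraph (Fin (m+1))) (E : Fin m → Fin (m+1) × Fin (m+1))
    (e : Fin m) (v : Fin (m+1)) : ℤ :=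
  if (T.deleteEdges {s((E e).1, (E e).2)}).Reachable (E e).1 v then 1 else 0

theorem auxS_congr {m : ℕ} (T : SimpleGraph (Fin (m+1))) (E : Fin m → Fin (m+1) × Fin (m+1))
    (e : Fin m) {u v : Fin (m+1)}
    (h : (T.deleteEdges {s((E e).1, (E e).2)}).Reachable u v) : auxS T E e u = auxS T E e v := by
  unfold auxS
  have : (T.deleteEdges {s((E e).1, (E e).2)}).Reachable (E e).1 u ↔
    (T.deleteEdges {s((E e).1, (E e).2)}).Reachable (E e).1 v :=
    ⟨fun k => k.trans h, fun k => k.trans h.symm⟩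
  classical exact if_congr this rfl rfl

theorem auxS_walk {m : ℕ} (T : SimpleGraph (Fin (m+1))) (E : Fin m → Fin (m+1) × Fin (m+1))
    (e : Fin m) {u v : Fin (m+1)} (p : T.Walk u v)
    (h : s((E e).1, (E e).2) ∉ p.edges) : auxS T E e u = auxS T E e v :=
  auxS_congr T E e ⟨p.toDeleteEdge _ h⟩

theorem auxS_one {m : ℕ} (T : SimpleGraph (Fin (m+1))) (E : Fin m → Fin (m+1) × Fin (m+1))
    (e : Fin m) : auxS T E e (E e).1 = 1 := by simp [auxS]

theorem auxS_zero {m : ℕ} (T : SimpleGraph (Fin (m+1))) (hT : T.IsTree)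
    (E : Fin m → Fin (m+1) × Fin (m+1)) (hE : ∀ i, T.Adj (E i).1 (E i).2)
    (e : Fin m) : auxS T E e (E e).2 = 0 := by
  have h := SimpleGraph.isAcyclic_iff_forall_adj_isBridge.1 hT.isAcyclic (hE e)
  rw [SimpleGraph.isBridge_iff] at h
  simp only [auxS]
  rw [if_neg]
  exact h

theorem auxS_adj {m : ℕ} (T : SimpleGraph (Fin (m+1))) (E : Fin m → Fin (m+1) × Fin (m+1))
    (e : Fin m) {u v : Fin (m+1)} (h : T.Adj u v) (hne : s(u, v) ≠ s((E e).1, (E e).2)) :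
    auxS T E e u = auxS T E e v := by
  apply auxS_congr
  apply SimpleGraph.Adj.reachable
  rw [SimpleGraph.deleteEdges_adj]
  exact ⟨h, by simpa using hne⟩

theorem auxS_edge {m : ℕ} (T : SimpleGraph (Fin (m+1))) (hT : T.IsTree)
    (E : Fin m → Fin (m+1) × Fin (m+1)) (hE : ∀ i, T.Adj (E i).1 (E i).2)
    (e : Fin m) {u v : Fin (m+1)} (h : s(u, v) = s((E e).1, (E e).2)) :
    ((auxS T E e u : ℝ) - auxS T E e v)^2 = 1 := by
  rcases Sym2.eq_iff.1 h with ⟨rfl, rfl⟩ | ⟨rfl, rfl⟩ <;>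
    simp [auxS_one, auxS_zero T hT E hE]

theorem aux_dist {m : ℕ} (T : SimpleGraph (Fin (m+1))) (hT : T.IsTree)
    (E : Fin m → Fin (m+1) × Fin (m+1)) (w : Fin m → ℝ)
    (hE : ∀ i, T.Adj (E i).1 (E i).2)
    {u v : Fin (m+1)} (p : T.Walk u v) (hp : p.IsPath) :
    (p.edges.map (fun s => ∑ i : Fin m, if s = s((E i).1, (E i).2) then w i else 0)).sum
      = ∑ e, w e * ((auxS T E e u : ℝ) - auxS T E e v)^2 := by
  induction p with
  | nil => simp
  | @cons u x v h p ih =>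
    have ht := hp.isTrail
    rw [SimpleGraph.Walk.isTrail_cons] at ht
    rw [SimpleGraph.Walk.edges_cons, List.map_cons, List.sum_cons, ih hp.of_cons,
      ← Finset.sum_add_distrib]
    refine Finset.sum_congr rfl fun e _ => ?_
    split_ifs with hh
    · have k1 := auxS_edge T hT E hE e hh
      have k2 := auxS_walk T E e p (hh ▸ ht.2)
      rw [← k2, k1]; ring
    · rw [auxS_adj T E e h hh]; ring

theorem aux_cnt {m : ℕ} (T : SimpleGraph (Fin (m+1))) (hT : T.IsTree)
    (E : Fin m → Fin (m+1) × Fin (m+1))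
    (hE : ∀ i, T.Adj (E i).1 (E i).2)
    (hinj : Function.Injective fun i => (s((E i).1, (E i).2) : Sym2 (Fin (m+1))))
    (hsurj : ∀ e ∈ T.edgeSet, ∃ i, e = s((E i).1, (E i).2))
    (v x : Fin (m+1)) (hvx : v ≠ x) :
    ∑ f, (auxQ E v f : ℝ)^2 * ((auxS T E f v : ℝ) - auxS T E f x)^2 = 1 := by
  obtain ⟨p, hp⟩ := (hT.isConnected.preconnected v x).exists_isPath
  cases p with
  | nil => exact absurd rfl hvx
  | @cons _ y _ h p =>
    rw [SimpleGraph.Walk.cons_isPath_iff] at hp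
    obtain ⟨g, hg⟩ := hsurj s(v, y) h
    have hav : ∀ f, v = (E f).1 ∨ v = (E f).2 → auxS T E f y = auxS T E f x := by
      intro f hf
      apply auxS_walk T E f p
      intro hmem
      rcases hf with hf | hf
      · exact hp.2 (hf ▸ p.fst_mem_support_of_mem_edges hmem)
      · exact hp.2 (hf ▸ p.snd_mem_support_of_mem_edges hmem)
    have hgv : v = (E g).1 ∨ v = (E g).2 := by
      rcases Sym2.eq_iff.1 hg with ⟨h, _⟩ | ⟨h, _⟩ <;> simp [h]
    rw [Finset.sum_eq_single g]
    · rw [← hav g hgv, auxS_edge T hT E hE g hg]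
      have := (hE g).ne
      rcases hgv with h | h <;> simp [auxQ, h, this, this.symm]
    · intro f _ hf
      by_cases hfv : v = (E f).1 ∨ v = (E f).2
      · rw [← hav f hfv, auxS_adj T E f h (by rw [hg]; exact fun k => hf (hinj k).symm)]
        ring
      · push Not at hfv
        simp [auxQ, hfv.1, hfv.2]
    · simp

theorem aux_deg {m : ℕ} (T : SimpleGraph (Fin (m+1)))
    (E : Fin m → Fin (m+1) × Fin (m+1))
    (hE : ∀ i, T.Adj (E i).1 (E i).2)
    (hinj : Function.Injective fun i => (s((E i).1, (E i).2) : Sym2 (Fin (m+1))))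
    (hsurj : ∀ e ∈ T.edgeSet, ∃ i, e = s((E i).1, (E i).2))
    (v : Fin (m+1)) : (degr T v : ℝ) = ∑ f, (auxQ E v f : ℝ)^2 := by
  have h1 : ∀ f, (auxQ E v f : ℝ)^2 = if (v = (E f).1 ∨ v = (E f).2) then 1 else 0 := by
    intro f
    have := (hE f).ne
    by_cases a : v = (E f).1
    · simp [auxQ, a, this]
    · by_cases b : v = (E f).2 <;> simp [auxQ, a, b, this.symm]
  simp only [h1, Finset.sum_boole]
  norm_cast
  unfold degr
  rw [← Set.ncard_coe_finset]
  symm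
  refine Set.ncard_congr (fun f _ => if v = (E f).1 then (E f).2 else (E f).1) ?_ ?_ ?_
  · intro f hf
    simp only [Finset.coe_filter, Finset.mem_univ, true_and, Set.mem_setOf_eq] at hf
    rw [SimpleGraph.mem_neighborSet]
    split_ifs with a
    · rw [a]; exact hE f
    · rw [hf.resolve_left a]; exact (hE f).symm
  · intro f g hf hg hfg
    simp only [Finset.coe_filter, Finset.mem_univ, true_and, Set.mem_setOf_eq] at hf hg
    apply hinj
    have key : ∀ f, (v = (E f).1 ∨ v = (E f).2) →
        s((E f).1, (E f).2) = s(v, if v = (E f).1 then (E f).2 else (E f).1) := by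
      intro f hf
      split_ifs with a
      · rw [← a]
      · rw [← hf.resolve_left a, Sym2.eq_swap]
    show s((E f).1, (E f).2) = s((E g).1, (E g).2)
    rw [key f hf, key g hg]
    exact congrArg (fun z => s(v, z)) hfg
  · intro y hy
    rw [SimpleGraph.mem_neighborSet] at hy
    obtain ⟨g, hg⟩ := hsurj s(v, y) hy
    refine ⟨g, ?_, ?_⟩
    · rcases Sym2.eq_iff.1 hg with ⟨h, _⟩ | ⟨h, _⟩ <;> simp [h]
    · have := (hE g).ne
      rcases Sym2.eq_iff.1 hg with ⟨h, k⟩ | ⟨h, k⟩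
      · simp [h, k]
      · simp [h, k, this.symm]

theorem stmt15 {n : ℕ} (T : SimpleGraph (Fin n)) (hT : T.IsTree)
    (E : Fin (n - 1) → Fin n × Fin n) (w : Fin (n - 1) → ℝ)
    (hw : ∀ i, w i ≠ 0)
    (hE : ∀ i, T.Adj (E i).1 (E i).2)
    (hinj : Function.Injective fun i => (s((E i).1, (E i).2) : Sym2 (Fin n)))
    (hsurj : ∀ e ∈ T.edgeSet, ∃ i, e = s((E i).1, (E i).2))
    (hdeg : ∀ v, degr T v ≠ 2) :
    ∑ i, ∑ j, (sqDistMat T hT.isConnected E w).adjugate i j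
      = (-1 : ℝ) ^ (n - 1) * (2 : ℝ) ^ (2 * (n : ℤ) - 3)
        * (∏ k, (w k) ^ 2) * ∏ v, (2 - (degr T v : ℝ)) := by
  obtain _ | m := n
  · exact (hT.isConnected.nonempty.some).elim0
  · exact aux_main E w (auxS T E) hw (auxS_one T E) (auxS_zero T hT E hE)
      (fun e f hf => auxS_adj T E e (hE f) (fun k => hf (hinj k)))
      (fun e v => by unfold auxS; split_ifs <;> simp)
      (fun u v => wdist T hT.isConnected E w u v)
      (fun u v => aux_dist T hT E w hE _ (SimpleGraph.Path.isPath _))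
      (fun v => (degr T v : ℝ)) (aux_deg T E hE hinj hsurj)
      (aux_cnt T hT E hE hinj hsurj)
      (fun v => by have := hdeg v; exact_mod_cast this)

end
end

section
/- Let T be a tree with vertex set {1,...,n} and nonzero real edge weights, having no vertex of degree 2, and let Δ be its squared distance matrix. Let β = Σ_{i=1}^n δ̂_i²/τ_i, where δ̂_i is the weighted degree of vertex i and τ_i = 2 - δ_i. If β ≠ 0, then Δ is nonsingular and 𝟙' Δ^{-1} 𝟙 = 4/β, where 𝟙 is the all-ones vector. -/
open Finset Matrix

noncomputable section

theorem aux_core {V : Type*} [Fintype V] [DecidableEq V] [Nonempty V]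
    (M D L : Matrix V V ℝ) (τ g : V → ℝ)
    (hL : Lᵀ = L) (h1 : ∀ v, ∑ u, L v u = 0) (hD : Dᵀ = D)
    (hMD : ∀ i j, M i j = D i j ^ 2) (hD0 : ∀ i, D i i = 0)
    (hLD : ∀ v i, (L * D) v i = τ v - if v = i then 2 else 0)
    (hLM : ∀ v i, (L * M) v i = 2 * τ v * D v i - g v)
    (hτ : ∀ v, τ v ≠ 0) (β : ℝ) (hβ : β = ∑ v, g v ^ 2 / τ v) (hβ0 : β ≠ 0) :
    M.det ≠ 0 ∧ ∑ i, ∑ j, M⁻¹ i j = 4 / β := by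
  have hLs : ∀ i j, L i j = L j i := fun i j => congrFun (congrFun hL j) i
  have hDs : ∀ i j, D i j = D j i := fun i j => congrFun (congrFun hD j) i
  have hMs : ∀ i j, M i j = M j i := fun i j => by rw [hMD, hMD, hDs]
  have hMT : Mᵀ = M := by ext i j; exact hMs j i
  have h1c : ∀ u, ∑ v, L v u = 0 := fun u => by
    rw [← h1 u]; exact Finset.sum_congr rfl fun v _ => hLs v u
  have hML : ∀ i v, (M * L) i v = 2 * τ v * D v i - g v := fun i v => by
    rw [← hLM v i, ← Matrix.transpose_apply (M * L), Matrix.transpose_mul, hL, hMT]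
  -- sum of τ is 2
  have hsτ : ∑ v, τ v = 2 := by
    obtain ⟨i⟩ := ‹Nonempty V›
    have e1 : ∑ v, (L * D) v i = 0 := by
      simp only [Matrix.mul_apply]
      rw [Finset.sum_comm]
      simp only [← Finset.sum_mul, h1c, zero_mul, Finset.sum_const_zero]
    simp only [hLD, Finset.sum_sub_distrib, Finset.sum_ite_eq', Finset.mem_univ, if_true] at e1
    linarith
  have hMτ : ∀ i, ∑ v, M i v * τ v = ∑ v, g v * D v i := by
    intro i
    have e1 : ∑ v, M i v * (L * D) v i = ∑ v, (M * L) i v * D v i := by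
      rw [← Matrix.mul_apply, ← Matrix.mul_apply, Matrix.mul_assoc]
    simp only [hLD, hML, mul_sub, sub_mul, Finset.sum_sub_distrib, mul_ite, mul_zero,
      Finset.sum_ite_eq', Finset.mem_univ, if_true] at e1
    have e2 : ∑ v, 2 * τ v * D v i * D v i = 2 * ∑ v, M i v * τ v := by
      rw [Finset.mul_sum]
      refine Finset.sum_congr rfl fun v _ => ?_
      rw [hMs, hMD]; ring
    have e3 : M i i = 0 := by rw [hMD, hD0]; norm_num
    rw [e2, e3] at e1
    linarith
  set y : V → ℝ := fun v => 2 * τ v - ∑ u, L v u * (g u / τ u) with hy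
  have hMy : ∀ i, ∑ v, M i v * y v = β := by
    intro i
    have e1 : ∑ v, M i v * ∑ u, L v u * (g u / τ u) = ∑ u, (M * L) i u * (g u / τ u) := by
      simp only [Matrix.mul_apply, Finset.mul_sum, Finset.sum_mul]
      rw [Finset.sum_comm]
      refine Finset.sum_congr rfl fun v _ => Finset.sum_congr rfl fun u _ => by ring
    have e2 : ∑ u, (M * L) i u * (g u / τ u) = 2 * ∑ v, g v * D v i - β := by
      rw [hβ, Finset.mul_sum, ← Finset.sum_sub_distrib]
      refine Finset.sum_congr rfl fun v _ => ?_
      rw [hML]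
      have := hτ v
      field_simp
    have e3 : ∑ v, M i v * (2 * τ v) = 2 * ∑ v, g v * D v i := by
      rw [← hMτ, Finset.mul_sum]
      exact Finset.sum_congr rfl fun v _ => by ring
    simp only [hy, mul_sub, Finset.sum_sub_distrib]
    rw [e1, e2, e3]; ring
  have hsy : ∑ v, y v = 4 := by
    simp only [hy, Finset.sum_sub_distrib, ← Finset.mul_sum, hsτ]
    rw [Finset.sum_comm]
    simp only [← Finset.sum_mul, h1c, zero_mul, Finset.sum_const_zero]
    norm_num
  have hLLM : ∀ v i, (L * (Matrix.diagonal (fun v => (τ v)⁻¹) * (L * M))) v i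
      = y v - if v = i then 4 else 0 := by
    intro v i
    have e0 : (L * (Matrix.diagonal (fun v => (τ v)⁻¹) * (L * M))) v i
        = 2 * (L * D) v i - ∑ u, L v u * (g u / τ u) := by
      rw [Matrix.mul_apply, Matrix.mul_apply, Finset.mul_sum, ← Finset.sum_sub_distrib]
      refine Finset.sum_congr rfl fun u _ => ?_
      rw [Matrix.diagonal_mul, hLM]
      have := hτ u
      field_simp
    rw [e0, hLD]
    simp only [hy]
    split_ifs <;> ring
  have hdet : M.det ≠ 0 := by
    intro h0
    obtain ⟨x, hx0, hx⟩ := Matrix.exists_mulVec_eq_zero_iff.mpr h0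
    have k1 : (L * (Matrix.diagonal (fun v => (τ v)⁻¹) * (L * M))) *ᵥ x = 0 := by
      rw [← Matrix.mul_assoc, ← Matrix.mul_assoc, ← Matrix.mulVec_mulVec, hx, Matrix.mulVec_zero]
    have k2 : ∀ v, 4 * x v = y v * ∑ i, x i := by
      intro v
      have := congrFun k1 v
      simp only [Matrix.mulVec, dotProduct, hLLM, sub_mul, ite_mul, zero_mul,
        Finset.sum_sub_distrib, Finset.sum_ite_eq, Finset.mem_univ, if_true,
        ← Finset.mul_sum, Pi.zero_apply] at this
      linarith
    have k3 : β * ∑ i, x i = 0 := by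
      obtain ⟨i⟩ := ‹Nonempty V›
      have := congrFun hx i
      simp only [Matrix.mulVec, dotProduct, Pi.zero_apply] at this
      rw [← hMy i, Finset.sum_mul]
      calc _ = ∑ v, 4 * (M i v * x v) := Finset.sum_congr rfl fun v _ => by
            rw [mul_assoc, ← k2]; ring
        _ = 0 := by rw [← Finset.mul_sum, this, mul_zero]
    have k4 : ∑ i, x i = 0 := (mul_eq_zero.mp k3).resolve_left hβ0
    apply hx0
    ext v
    have := k2 v
    rw [k4] at this
    simpa using this
  refine ⟨hdet, ?_⟩
  have hMyv : M *ᵥ y = fun _ => β := funext hMy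
  have hinv : M⁻¹ *ᵥ (fun _ => β) = y := by
    rw [← hMyv, Matrix.mulVec_mulVec, Matrix.nonsing_inv_mul _ (isUnit_iff_ne_zero.mpr hdet),
      Matrix.one_mulVec]
  rw [eq_div_iff hβ0, ← hsy, Finset.sum_mul]
  refine Finset.sum_congr rfl fun i _ => ?_
  rw [← hinv, Matrix.mulVec, dotProduct, Finset.sum_mul]

/-- the weight of an edge -/
def eW {n : ℕ} (E : Fin (n-1) → Fin n × Fin n) (w : Fin (n-1) → ℝ) (s : Sym2 (Fin n)) : ℝ :=
  ∑ i : Fin (n-1), if s = s((E i).1, (E i).2) then w i else 0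

theorem wdist_eq {n : ℕ} (T : SimpleGraph (Fin n)) (hT : T.IsTree)
    (E : Fin (n-1) → Fin n × Fin n) (w : Fin (n-1) → ℝ) {u v : Fin n} (p : T.Walk u v)
    (hp : p.IsPath) : wdist T hT.isConnected E w u v = (p.edges.map (eW E w)).sum := by
  unfold wdist
  have := hT.isAcyclic.path_unique ((Nonempty.some (hT.isConnected.preconnected u v)).toPath)
    ⟨p, hp⟩
  rw [this]
  rfl

theorem wdist_self {n : ℕ} (T : SimpleGraph (Fin n)) (hT : T.IsTree)
    (E : Fin (n-1) → Fin n × Fin n) (w : Fin (n-1) → ℝ) (u : Fin n) :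
    wdist T hT.isConnected E w u u = 0 := by
  rw [wdist_eq T hT E w SimpleGraph.Walk.nil SimpleGraph.Walk.IsPath.nil]; simp

theorem wdist_comm {n : ℕ} (T : SimpleGraph (Fin n)) (hT : T.IsTree)
    (E : Fin (n-1) → Fin n × Fin n) (w : Fin (n-1) → ℝ) (u v : Fin n) :
    wdist T hT.isConnected E w u v = wdist T hT.isConnected E w v u := by
  obtain ⟨p, hp⟩ := hT.isConnected.exists_isPath u v
  rw [wdist_eq T hT E w p hp, wdist_eq T hT E w p.reverse hp.reverse]
  simp

/-- walking from `v` towards `i`. -/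
theorem wdist_step {n : ℕ} (T : SimpleGraph (Fin n)) (hT : T.IsTree)
    (E : Fin (n-1) → Fin n × Fin n) (w : Fin (n-1) → ℝ) (v i : Fin n) (hvi : v ≠ i) :
    ∃ u, T.Adj v u ∧
      wdist T hT.isConnected E w v i = wdist T hT.isConnected E w u i + eW E w s(v, u) ∧
      ∀ x, T.Adj v x → x ≠ u →
        wdist T hT.isConnected E w x i = wdist T hT.isConnected E w v i + eW E w s(v, x) := by
  obtain ⟨p, hp⟩ := hT.isConnected.exists_isPath v i
  cases p with
  | nil => exact absurd rfl hvi
  | @cons _ u _ h q =>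
    have hq := (SimpleGraph.Walk.cons_isPath_iff h q).mp hp
    refine ⟨u, h, ?_, ?_⟩
    · rw [wdist_eq T hT E w _ hp, wdist_eq T hT E w _ hq.1]
      simp [add_comm]
    · intro x hx hxu
      have hns : x ∉ (SimpleGraph.Walk.cons h q).support := by
        intro hm
        have ht : ((SimpleGraph.Walk.cons h q).takeUntil x hm).IsPath := hp.takeUntil hm
        have he := hT.isAcyclic.path_unique ⟨_, ht⟩ (SimpleGraph.Path.singleton hx)
        have he' := congrArg Subtype.val he
        have hs := (SimpleGraph.Walk.cons h q).take_spec hm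
        simp only [SimpleGraph.Path.singleton] at he'
        rw [he'] at hs
        have := congrArg (fun r => r.getVert 1) hs
        simp at this
        exact hxu this
      have hpx : (SimpleGraph.Walk.cons hx.symm (SimpleGraph.Walk.cons h q)).IsPath :=
        (SimpleGraph.Walk.cons_isPath_iff _ _).mpr ⟨hp, hns⟩
      rw [wdist_eq T hT E w _ hpx, wdist_eq T hT E w _ hp]
      simp [Sym2.eq_swap, add_comm]

theorem wdist_adj {n : ℕ} (T : SimpleGraph (Fin n)) (hT : T.IsTree)
    (E : Fin (n-1) → Fin n × Fin n) (w : Fin (n-1) → ℝ) (v x : Fin n) (h : T.Adj v x) :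
    wdist T hT.isConnected E w x v = eW E w s(v, x) := by
  rw [wdist_eq T hT E w _ (SimpleGraph.Path.singleton h.symm).2]
  simp [SimpleGraph.Path.singleton, Sym2.eq_swap]

theorem sum_modify {V : Type*} [DecidableEq V] (N : Finset V) (F a : V → ℝ) (p : V) (hp : p ∈ N)
    (h : ∀ x ∈ N, x ≠ p → F x = a x) : ∑ x ∈ N, F x = ∑ x ∈ N, a x + (F p - a p) := by
  rw [← Finset.add_sum_erase _ _ hp, ← Finset.add_sum_erase _ a hp,
    Finset.sum_congr rfl (fun x hx => h x (Finset.mem_of_mem_erase hx) (Finset.ne_of_mem_erase hx))]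
  ring

theorem stmt16 {n : ℕ} (T : SimpleGraph (Fin n)) (hT : T.IsTree)
    (E : Fin (n - 1) → Fin n × Fin n) (w : Fin (n - 1) → ℝ)
    (hw : ∀ i, w i ≠ 0)
    (hE : ∀ i, T.Adj (E i).1 (E i).2)
    (hinj : Function.Injective fun i => (s((E i).1, (E i).2) : Sym2 (Fin n)))
    (hsurj : ∀ e ∈ T.edgeSet, ∃ i, e = s((E i).1, (E i).2))
    (hdeg : ∀ v, degr T v ≠ 2)
    (β : ℝ) (hβdef : β = ∑ v, (wdeg E w v) ^ 2 / (2 - (degr T v : ℝ)))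
    (hβ : β ≠ 0) :
    (sqDistMat T hT.isConnected E w).det ≠ 0 ∧
      ∑ i, ∑ j, (sqDistMat T hT.isConnected E w)⁻¹ i j = 4 / β := by
  classical
  have hne : Nonempty (Fin n) := hT.isConnected.nonempty
  set W : Fin n → Fin n → ℝ := fun v u => eW E w s(v, u) with hWdef
  have hWs : ∀ u v, W u v = W v u := fun u v => by simp only [hWdef, Sym2.eq_swap]
  have hWi : ∀ i, eW E w s((E i).1, (E i).2) = w i := by
    intro i
    unfold eW
    rw [Finset.sum_eq_single i]
    · simp
    · intro b _ hb
      rw [if_neg]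
      intro h
      exact hb (hinj h).symm
    · simp
  have hW0 : ∀ u v, T.Adj u v → W u v ≠ 0 := by
    intro u v h
    obtain ⟨i, hi⟩ := hsurj s(u, v) h
    simp only [hWdef]
    rw [hi, hWi]
    exact hw i
  have hdegr : ∀ v, degr T v = (T.neighborFinset v).card := by
    intro v
    unfold degr
    rw [Set.ncard_eq_toFinset_card']
    rfl
  have hwdeg : ∀ v, wdeg E w v = ∑ u ∈ T.neighborFinset v, W v u := by
    intro v
    unfold wdeg
    refine Finset.sum_bij (fun k _ => if (E k).1 = v then (E k).2 else (E k).1) ?_ ?_ ?_ ?_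
    · intro k hk
      have hk' := (Finset.mem_filter.mp hk).2
      rw [SimpleGraph.mem_neighborFinset]
      have := hE k
      split_ifs with h
      · rw [← h]; exact this
      · rw [← hk'.resolve_left h]; exact this.symm
    · intro k hk l hl h
      have hk' := (Finset.mem_filter.mp hk).2
      have hl' := (Finset.mem_filter.mp hl).2
      apply hinj
      simp only [Sym2.eq_iff]
      grind
    · intro u hu
      rw [SimpleGraph.mem_neighborFinset] at hu
      obtain ⟨k, hk⟩ := hsurj s(v, u) hu
      have hne := hu.ne
      rw [Sym2.eq_iff] at hk
      refine ⟨k, ?_, ?_⟩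
      · simp; grind
      · grind
    · intro k hk
      have hk' := (Finset.mem_filter.mp hk).2
      simp only [hWdef]
      rw [← hWi k]
      congr 1
      split_ifs with h
      · rw [h]
      · rw [← hk'.resolve_left h, Sym2.eq_swap]
  set D : Fin n → Fin n → ℝ := fun u v => wdist T hT.isConnected E w u v with hDdef
  set c : Fin n → Fin n → ℝ := fun v u => if T.Adj v u then (W v u)⁻¹ else 0 with hc
  have hcs : ∀ u v, c u v = c v u := fun u v => by
    simp only [hc, T.adj_comm u v, hWs u v]
  set L : Matrix (Fin n) (Fin n) ℝ := Matrix.of fun v u =>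
    (if v = u then ∑ x, c v x else 0) - c v u with hLdef
  have hLmul : ∀ (A : Matrix (Fin n) (Fin n) ℝ) v i,
      (L * A) v i = ∑ u ∈ T.neighborFinset v, (A v i - A u i) / W v u := by
    intro A v i
    rw [Matrix.mul_apply]
    simp only [hLdef, Matrix.of_apply, sub_mul, Finset.sum_sub_distrib, ite_mul, zero_mul,
      Finset.sum_ite_eq, Finset.mem_univ, if_true]
    rw [Finset.sum_mul, ← Finset.sum_sub_distrib, SimpleGraph.neighborFinset_eq_filter,
      Finset.sum_filter]
    refine Finset.sum_congr rfl fun u _ => ?_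
    simp only [hc]
    split_ifs
    · ring
    · ring
  refine aux_core (sqDistMat T hT.isConnected E w) (Matrix.of D) L
    (fun v => 2 - (degr T v : ℝ)) (wdeg E w) ?_ ?_ ?_ ?_ ?_ ?_ ?_ ?_ β hβdef hβ
  · ext i j
    simp only [Matrix.transpose_apply, hLdef, Matrix.of_apply, hcs j i]
    by_cases h : i = j
    · subst h; rfl
    · rw [if_neg h, if_neg (Ne.symm h)]
  · intro v
    simp [hLdef, Finset.sum_sub_distrib]
  · ext i j
    exact wdist_comm T hT E w j i
  · intro i j; rfl
  · intro i; exact wdist_self T hT E w i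
  · intro v i
    rw [hLmul, hdegr]
    simp only [Matrix.of_apply]
    by_cases hvi : v = i
    · subst hvi
      rw [Finset.sum_congr rfl (g := fun _ => (-1 : ℝ))]
      · simp
      · intro x hx
        rw [SimpleGraph.mem_neighborFinset] at hx
        have h0 := hW0 v x hx
        have h1 : D x v = W v x := wdist_adj T hT E w v x hx
        have h2 : D v v = 0 := wdist_self T hT E w v
        rw [h1, h2]; field_simp; ring
    · obtain ⟨u, hu, h1, h2⟩ := wdist_step T hT E w v i hvi
      rw [sum_modify _ _ (fun _ => (-1 : ℝ)) u (by simpa using hu), if_neg hvi]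
      · have h0 := hW0 v u hu
        have h1' : D v i = D u i + W v u := h1
        rw [h1']; simp; field_simp; ring
      · intro x hx hxu
        rw [SimpleGraph.mem_neighborFinset] at hx
        have h0 := hW0 v x hx
        have h1' : D x i = D v i + W v x := h2 x hx hxu
        rw [h1']; field_simp; ring
  · intro v i
    rw [hLmul, hdegr, hwdeg]
    simp only [Matrix.of_apply, sqDistMat]
    change ∑ u ∈ T.neighborFinset v, (D v i ^ 2 - D u i ^ 2) / W v u = _
    by_cases hvi : v = i
    · subst hvi
      have h2 : D v v = 0 := wdist_self T hT E w v
      rw [h2, mul_zero, zero_sub, ← Finset.sum_neg_distrib]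
      refine Finset.sum_congr rfl fun x hx => ?_
      rw [SimpleGraph.mem_neighborFinset] at hx
      have h0 := hW0 v x hx
      have h1 : D x v = W v x := wdist_adj T hT E w v x hx
      rw [h1]; field_simp; ring
    · obtain ⟨u, hu, h1, h2⟩ := wdist_step T hT E w v i hvi
      rw [sum_modify _ _ (fun x => -2 * D v i - W v x) u (by simpa using hu)]
      · have h0 := hW0 v u hu
        have h1' : D u i = D v i - W v u := by
          have h1' : D v i = D u i + W v u := h1
          rw [h1']; ring
        rw [h1', Finset.sum_sub_distrib, Finset.sum_const, nsmul_eq_mul]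
        field_simp; ring
      · intro x hx hxu
        rw [SimpleGraph.mem_neighborFinset] at hx
        have h0 := hW0 v x hx
        have h1' : D x i = D v i + W v x := h2 x hx hxu
        rw [h1']; field_simp; ring
  · intro v h
    have : (degr T v : ℝ) = 2 := by linarith
    exact hdeg v (by exact_mod_cast this)

end
end

section
/- Let T be a tree with vertex set {1,...,n} whose edges e_1,...,e_{n-1} are assigned nonzero real weights w_1,...,w_{n-1}, with w_1 + ... + w_{n-1} ≠ 0. Let D be the weighted distance matrix and L the weighted Laplacian of T, and let τ be the vector with components τ_i = 2 - δ_i where δ_i is the degree of vertex i. Then D L = -2I + 𝟙 τ', where I is the n×n identity matrix and 𝟙 is the all-ones vector. -/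
open Finset Matrix

noncomputable section

/-- The weighted distance may be computed along any path. -/
theorem wdist_eq_of_path {n : ℕ} (T : SimpleGraph (Fin n)) (hT : T.IsTree)
    (E : Fin (n-1) → Fin n × Fin n) (w : Fin (n-1) → ℝ) (u v : Fin n)
    (p : T.Walk u v) (hp : p.IsPath) :
    wdist T hT.isConnected E w u v = (p.edges.map
      (fun s => ∑ i : Fin (n-1), if s = s((E i).1, (E i).2) then w i else 0)).sum := by
  have h := hT.isAcyclic.path_unique
    (Nonempty.some (hT.isConnected.preconnected u v)).toPath ⟨p, hp⟩
  unfold wdist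
  rw [h]

/-- Extending a path by one edge adds the weight of this edge. -/
theorem wdist_concat {n : ℕ} (T : SimpleGraph (Fin n)) (hT : T.IsTree)
    (E : Fin (n-1) → Fin n × Fin n) (w : Fin (n-1) → ℝ)
    (hinj : Function.Injective fun i => (s((E i).1, (E i).2) : Sym2 (Fin n)))
    (u x v : Fin n) (k : Fin (n-1)) (hk : s(x, v) = s((E k).1, (E k).2))
    (h : T.Adj x v) (p : T.Walk u x) (hp : p.IsPath) (hv : v ∉ p.support) :
    wdist T hT.isConnected E w u v = wdist T hT.isConnected E w u x + w k := by
  rw [wdist_eq_of_path T hT E w u x p hp,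
    wdist_eq_of_path T hT E w u v (p.concat h) (hp.concat hv h)]
  rw [SimpleGraph.Walk.edges_concat, List.concat_eq_append, List.map_append, List.sum_append]
  congr 1
  rw [List.map_singleton, List.sum_singleton, Finset.sum_eq_single k]
  · simp [hk]
  · intro b _ hb
    rw [if_neg]
    intro hh
    exact hb (hinj (hh.symm.trans hk))
  · simp

/-- The difference of distances to adjacent vertices. -/
theorem wdist_diff {n : ℕ} (T : SimpleGraph (Fin n)) (hT : T.IsTree)
    (E : Fin (n-1) → Fin n × Fin n) (w : Fin (n-1) → ℝ)
    (hinj : Function.Injective fun i => (s((E i).1, (E i).2) : Sym2 (Fin n)))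
    (u v : Fin n) (p : T.Walk u v) (hp : p.IsPath)
    (x : Fin n) (k : Fin (n-1)) (hk : s(x, v) = s((E k).1, (E k).2))
    (h : T.Adj x v) :
    wdist T hT.isConnected E w u v - wdist T hT.isConnected E w u x
      = (if x = p.penultimate then 1 else -1) * w k := by
  obtain ⟨q, hq⟩ := (Nonempty.some (hT.isConnected.preconnected u x)).toPath
  by_cases hv : v ∈ q.support
  · have hx := SimpleGraph.Walk.endpoint_notMem_support_takeUntil hq hv h.ne
    have he : p = q.takeUntil v hv := congrArg Subtype.val
      (hT.isAcyclic.path_unique ⟨p, hp⟩ ⟨q.takeUntil v hv, hq.takeUntil hv⟩)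
    rw [← he] at hx
    have hne : x ≠ p.penultimate := by
      rintro rfl
      exact hx (p.getVert_mem_support _)
    rw [if_neg hne, wdist_concat T hT E w hinj u v x k (by rw [Sym2.eq_swap, hk]) h.symm p hp hx]
    ring
  · have he : p = q.concat h := congrArg Subtype.val
      (hT.isAcyclic.path_unique ⟨p, hp⟩ ⟨q.concat h, hq.concat hv h⟩)
    have hpen : x = p.penultimate := by rw [he, SimpleGraph.Walk.penultimate_concat]
    rw [if_pos hpen, wdist_concat T hT E w hinj u x v k hk h q hq hv]
    ring

/-- The diagonal entries of the Laplacian as sums of conductances. -/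
theorem lap_diag {n : ℕ} (T : SimpleGraph (Fin n))
    (E : Fin (n-1) → Fin n × Fin n) (w : Fin (n-1) → ℝ)
    (hE : ∀ i, T.Adj (E i).1 (E i).2) (v : Fin n) :
    ∑ k ∈ univ.filter (fun k => (E k).1 = v ∨ (E k).2 = v), (w k)⁻¹ =
      ∑ x, ∑ k ∈ univ.filter (fun k => E k = (x, v) ∨ E k = (v, x)), (w k)⁻¹ := by
  simp only [Finset.sum_filter]
  rw [Finset.sum_comm]
  refine Finset.sum_congr rfl fun k _ => ?_
  have hne := (hE k).ne
  generalize E k = e at hne ⊢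
  obtain ⟨a, b⟩ := e
  simp only [Prod.mk.injEq]
  change a ≠ b at hne
  by_cases ha : a = v
  · subst ha
    rw [Finset.sum_eq_single b]
    · simp
    · intro x _ hx
      rw [if_neg]
      rintro (⟨_, h⟩ | ⟨_, h⟩)
      · exact hne h.symm
      · exact hx h.symm
    · simp
  · by_cases hb : b = v
    · subst hb
      rw [Finset.sum_eq_single a]
      · simp
      · intro x _ hx
        rw [if_neg]
        rintro (⟨h, _⟩ | ⟨h, _⟩)
        · exact hx h.symm
        · exact hne h
      · simp
    · simp [ha, hb]

/-- The conductance between adjacent vertices. -/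
theorem cond_adj {n : ℕ}
    (E : Fin (n-1) → Fin n × Fin n) (w : Fin (n-1) → ℝ)
    (hinj : Function.Injective fun i => (s((E i).1, (E i).2) : Sym2 (Fin n)))
    (x v : Fin n) (k : Fin (n-1)) (hk : s(x, v) = s((E k).1, (E k).2)) :
    ∑ k ∈ univ.filter (fun k => E k = (x, v) ∨ E k = (v, x)), (w k)⁻¹ = (w k)⁻¹ := by
  have : univ.filter (fun k => E k = (x, v) ∨ E k = (v, x)) = {k} := by
    ext j
    have h1 : (E j = (x, v) ∨ E j = (v, x)) ↔ s(x, v) = s((E j).1, (E j).2) := by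
      rw [Sym2.eq_iff, Prod.ext_iff, Prod.ext_iff]
      grind
    simp only [Finset.mem_filter, Finset.mem_univ, true_and, Finset.mem_singleton, h1]
    constructor
    · intro h
      exact hinj (h.symm.trans hk)
    · rintro rfl
      exact hk
  rw [this, Finset.sum_singleton]

/-- The conductance between nonadjacent vertices. -/
theorem cond_not_adj {n : ℕ} (T : SimpleGraph (Fin n))
    (E : Fin (n-1) → Fin n × Fin n) (w : Fin (n-1) → ℝ)
    (hE : ∀ i, T.Adj (E i).1 (E i).2) (x v : Fin n) (h : ¬ T.Adj x v) :
    ∑ k ∈ univ.filter (fun k => E k = (x, v) ∨ E k = (v, x)), (w k)⁻¹ = 0 := by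
  apply Finset.sum_eq_zero
  intro k hk
  exfalso
  have := hE k
  rcases (Finset.mem_filter.1 hk).2 with hk | hk
  · rw [hk] at this
    exact h this
  · rw [hk] at this
    exact h this.symm

theorem stmt19 {n : ℕ} (T : SimpleGraph (Fin n)) (hT : T.IsTree)
    (E : Fin (n - 1) → Fin n × Fin n) (w : Fin (n - 1) → ℝ)
    (hw : ∀ i, w i ≠ 0)
    (hE : ∀ i, T.Adj (E i).1 (E i).2)
    (hinj : Function.Injective fun i => (s((E i).1, (E i).2) : Sym2 (Fin n)))
    (hsurj : ∀ e ∈ T.edgeSet, ∃ i, e = s((E i).1, (E i).2))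
    (hsw : (∑ i, w i) ≠ 0) :
    distMat T hT.isConnected E w * lap E w
      = (-2 : ℝ) • (1 : Matrix (Fin n) (Fin n) ℝ)
        + Matrix.vecMulVec (fun _ => (1 : ℝ)) (fun v => 2 - (degr T v : ℝ)) := by
  classical
  ext u v
  obtain ⟨p, hp⟩ := (Nonempty.some (hT.isConnected.preconnected u v)).toPath
  have key : (distMat T hT.isConnected E w * lap E w) u v =
      ∑ x, if T.Adj x v then (if x = p.penultimate then (1 : ℝ) else -1) else 0 := by
    have h1 : (distMat T hT.isConnected E w * lap E w) u v =
        ∑ x, (wdist T hT.isConnected E w u v - wdist T hT.isConnected E w u x) *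
          ∑ k ∈ univ.filter (fun k => E k = (x, v) ∨ E k = (v, x)), (w k)⁻¹ := by
      have h2 : ∀ x, lap E w x v =
          (if x = v then ∑ y, ∑ k ∈ univ.filter (fun k => E k = (y, v) ∨ E k = (v, y)), (w k)⁻¹
            else 0) - ∑ k ∈ univ.filter (fun k => E k = (x, v) ∨ E k = (v, x)), (w k)⁻¹ := by
        intro x
        by_cases hx : x = v
        · subst hx
          rw [cond_not_adj T E w hE x x (SimpleGraph.irrefl T)]
          rw [← lap_diag T E w hE]
          simp [lap]
        · simp [lap, hx]
      rw [Matrix.mul_apply]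
      simp only [h2, distMat, Matrix.of_apply, mul_sub, sub_mul, Finset.sum_sub_distrib,
        mul_ite, mul_zero, Finset.sum_ite_eq', Finset.mem_univ, if_true, Finset.mul_sum]
    rw [h1]
    refine Finset.sum_congr rfl fun x _ => ?_
    by_cases h : T.Adj x v
    · obtain ⟨k, hk⟩ := hsurj s(x, v) h
      rw [if_pos h, cond_adj E w hinj x v k hk, wdist_diff T hT E w hinj u v p hp x k hk h,
        mul_assoc, mul_inv_cancel₀ (hw k), mul_one]
    · rw [if_neg h, cond_not_adj T E w hE x v h, mul_zero]
  have hdeg : (degr T v : ℝ) = ∑ x, if T.Adj x v then (1 : ℝ) else 0 := by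
    rw [Finset.sum_boole, degr, ← Set.ncard_coe_finset]
    congr 2
    ext x
    simp [SimpleGraph.adj_comm]
  have hsplit : (∑ x, if T.Adj x v then (if x = p.penultimate then (1 : ℝ) else -1) else 0) =
      2 * (if T.Adj p.penultimate v then 1 else 0) - degr T v := by
    rw [hdeg]
    have h3 : (2 * (if T.Adj p.penultimate v then 1 else 0) : ℝ) =
        ∑ x, if x = p.penultimate then (2 * (if T.Adj x v then 1 else 0) : ℝ) else 0 := by
      simp
    rw [h3, ← Finset.sum_sub_distrib]
    refine Finset.sum_congr rfl fun x _ => ?_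
    split_ifs <;> norm_num
  rw [key, hsplit]
  simp only [Matrix.add_apply, Matrix.smul_apply, Matrix.vecMulVec_apply, smul_eq_mul, one_mul]
  by_cases huv : u = v
  · subst huv
    have : p = SimpleGraph.Walk.nil := SimpleGraph.Walk.isPath_iff_eq_nil.1 hp
    subst this
    simp
    ring
  · rw [if_pos (SimpleGraph.Walk.adj_penultimate (SimpleGraph.Walk.not_nil_of_ne huv)),
      Matrix.one_apply_ne huv]
    ring

end
end
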